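/- arXiv:2006.15328 — 7 statements merged into one kernel-verified Lean document; each statement's English description precedes it below -/
import Mathlib

section
/- For every 0 < c < 1 and every x ∈ G with u_p(x) ≤ c, one has the uniform gradient bound |∇u_p(x)| ≤ (1/(1−c))^{1/(p−2)}. -/
open Set Metric
open scoped RealInnerProductSpace

noncomputable section

abbrev E2 : Type := EuclideanSpace ℝ (Fin 2)

/-- The ∞-Laplacian `Δ∞v(x) = ⟨D²v(x)∇v(x), ∇v(x)⟩`. -/
def lapInf (v : E2 → ℝ) (x : E2) : ℝ :=
  ⟪fderiv ℝ (gradient v) x (gradient v x), gradient v x⟫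

/-- The Laplacian `Δv(x)`, as the trace of the Hessian `D²v(x)`. -/
def lap (v : E2 → ℝ) (x : E2) : ℝ :=
  LinearMap.trace ℝ E2 (fderiv ℝ (gradient v) x : E2 →ₗ[ℝ] E2)

open Filter Topology

/-- The vector `e` turned by a quarter of a circle. -/
def quarterTurn (e : E2) : E2 := !₂[-e 1, e 0]

lemma inner_quarterTurn (e : E2) : ⟪e, quarterTurn e⟫ = 0 := by
  simp [quarterTurn, PiLp.inner_apply, Fin.sum_univ_two]; ring

lemma norm_sq_quarterTurn (e : E2) : ‖quarterTurn e‖ ^ 2 = ‖e‖ ^ 2 := by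
  simp [quarterTurn, EuclideanSpace.norm_sq_eq, Fin.sum_univ_two]; ring

lemma inner_apply_add_inner_apply_quarterTurn (M : E2 →L[ℝ] E2) (e : E2) :
    ⟪M e, e⟫ + ⟪M (quarterTurn e), quarterTurn e⟫ =
      ‖e‖ ^ 2 * LinearMap.trace ℝ E2 (M : E2 →ₗ[ℝ] E2) := by
  have hb : ∀ v : E2, v = v 0 • EuclideanSpace.single 0 1 + v 1 • EuclideanSpace.single 1 1 := by
    intro v; ext i; fin_cases i <;> simp
  have hM : ∀ v : E2, M v = v 0 • M (EuclideanSpace.single 0 1) +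
      v 1 • M (EuclideanSpace.single 1 1) := by
    intro v
    conv_lhs => rw [hb v]
    simp
  rw [LinearMap.trace_eq_sum_inner _ (EuclideanSpace.basisFun (Fin 2) ℝ), hM e, hM (quarterTurn e)]
  simp [quarterTurn, EuclideanSpace.norm_sq_eq, PiLp.inner_apply, Fin.sum_univ_two]
  ring

/-- If `∇u` is a multiple of `e`, the `p`-harmonic equation only involves the second derivatives
along `e` and across `e`. -/
lemma pharmonic_frame {p : ℝ} {u : E2 → ℝ} {x e : E2} {g : ℝ}
    (hne : gradient u x ≠ 0) (he : gradient u x = g • e)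
    (h : (p - 2) * lapInf u x + ‖gradient u x‖ ^ 2 * lap u x = 0) :
    (p - 1) * ⟪fderiv ℝ (gradient u) x e, e⟫ +
      ⟪fderiv ℝ (gradient u) x (quarterTurn e), quarterTurn e⟫ = 0 := by
  have hg : g ≠ 0 := by rintro rfl; simp [he] at hne
  have ht := inner_apply_add_inner_apply_quarterTurn (fderiv ℝ (gradient u) x) e
  have hg2 : g ^ 2 ≠ 0 := by positivity
  rw [lapInf, lap, he, norm_smul, map_smul, inner_smul_left, inner_smul_right, mul_pow,
    Real.norm_eq_abs, sq_abs] at h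
  simp only [conj_trivial] at h
  apply mul_left_cancel₀ hg2
  linear_combination h + g ^ 2 * ht

/-- `h` is differentiable near `0` and twice differentiable at `0`, with first and second
derivatives `a` and `b` at `0`. -/
def HasJet (h : ℝ → ℝ) (a b : ℝ) : Prop :=
  ∃ h' : ℝ → ℝ, (∀ᶠ t in 𝓝 0, HasDerivAt h (h' t) t) ∧ h' 0 = a ∧ HasDerivAt h' b 0

namespace HasJet

variable {f h : ℝ → ℝ} {a b c d : ℝ}

lemma hasDerivAt (hf : HasJet f a b) : HasDerivAt f a 0 := by
  obtain ⟨f', h1, rfl, -⟩ := hf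
  exact h1.self_of_nhds

lemma continuousAt (hf : HasJet f a b) : ContinuousAt f 0 := hf.hasDerivAt.continuousAt

lemma const (c : ℝ) : HasJet (fun _ => c) 0 0 :=
  ⟨fun _ => 0, .of_forall fun _ => hasDerivAt_const _ _, rfl, hasDerivAt_const _ _⟩

lemma sub (hf : HasJet f a b) (hh : HasJet h c d) :
    HasJet (fun t => f t - h t) (a - c) (b - d) := by
  obtain ⟨f', h1, rfl, h2⟩ := hf
  obtain ⟨g', h3, rfl, h4⟩ := hh
  exact ⟨fun t => f' t - g' t, by filter_upwards [h1, h3] with t h h' using h.sub h', rfl,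
    h2.sub h4⟩

lemma const_mul (k : ℝ) (hf : HasJet f a b) : HasJet (fun t => k * f t) (k * a) (k * b) := by
  obtain ⟨f', h1, rfl, h2⟩ := hf
  exact ⟨fun t => k * f' t, by filter_upwards [h1] with t h using h.const_mul k, rfl,
    h2.const_mul k⟩

lemma quadratic (k l m : ℝ) : HasJet (fun t => k + l * t + m * t ^ 2) l (2 * m) := by
  refine ⟨fun t => l + 2 * m * t, .of_forall fun t => ?_, by simp, ?_⟩
  · have := (((hasDerivAt_id t).const_mul l).const_add k).add ((hasDerivAt_pow 2 t).const_mul m)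
    refine (this.congr_deriv ?_).congr_of_eventuallyEq (.of_forall fun t => ?_)
    · norm_num; ring
    · simp
  · simpa using ((hasDerivAt_id (0 : ℝ)).const_mul (2 * m)).const_add l

lemma rpow (hf : HasJet f a b) (h0 : 0 < f 0) (q : ℝ) :
    HasJet (fun t => f t ^ q) (q * f 0 ^ (q - 1) * a)
      (q * (q - 1) * f 0 ^ (q - 2) * a ^ 2 + q * f 0 ^ (q - 1) * b) := by
  have hpos : ∀ᶠ t in 𝓝 0, 0 < f t := hf.continuousAt.eventually (lt_mem_nhds h0)
  have hf1 := hf.hasDerivAt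
  obtain ⟨f', h1, rfl, h2⟩ := hf
  refine ⟨fun t => f' t * q * f t ^ (q - 1), ?_, by ring, ?_⟩
  · filter_upwards [h1, hpos] with t h h' using h.rpow_const (Or.inl h'.ne')
  · refine ((h2.mul_const q).mul
      (hf1.rpow_const (p := q - 1) (Or.inl h0.ne'))).congr_deriv ?_
    rw [show q - 1 - 1 = q - 2 by ring]
    ring

lemma nonpos_of_isLocalMax (hf : HasJet f a b) (hm : IsLocalMax f 0) : a = 0 ∧ b ≤ 0 := by
  have ha : a = 0 := hm.hasDerivAt_eq_zero hf.hasDerivAt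
  refine ⟨ha, ?_⟩
  by_contra! hb
  obtain ⟨F', h1, hF0, h2⟩ := hf.sub (quadratic 0 0 (b / 4))
  have hd : deriv (fun t => f t - (0 + 0 * t + b / 4 * t ^ 2)) =ᶠ[𝓝 0] F' := by
    filter_upwards [h1] with t h using h.deriv
  have hmin := isLocalMin_of_deriv_deriv_pos (x₀ := 0) (by
      rw [hd.deriv_eq, h2.deriv]; linarith) (by rw [hd.self_of_nhds, hF0, ha]; simp)
      h1.self_of_nhds.continuousAt
  have hev : ∀ᶠ t in 𝓝[≠] (0 : ℝ), False := by
    filter_upwards [hmin.filter_mono nhdsWithin_le_nhds, hm.filter_mono nhdsWithin_le_nhds,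
      self_mem_nhdsWithin] with t h3 h4 h5
    have : 0 < t ^ 2 := by have : t ≠ 0 := h5; positivity
    nlinarith
  exact hev.exists.elim fun _ h => h

end HasJet

lemma hasJet_line {u : E2 → ℝ} {G : Set E2} (hG : IsOpen G) (hu : ContDiffOn ℝ (⊤ : ℕ∞) u G)
    {x : E2} (hx : x ∈ G) (d : E2) :
    HasJet (fun t : ℝ => u (x + t • d)) ⟪gradient u x, d⟫
      ⟪fderiv ℝ (gradient u) x d, d⟫ := by
  have hline : ∀ t : ℝ, HasDerivAt (fun t : ℝ => x + t • d) d t := fun t => by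
    simpa using ((hasDerivAt_id t).smul_const d).const_add x
  have hmem : ∀ᶠ t : ℝ in 𝓝 0, x + t • d ∈ G :=
    (hline 0).continuousAt.eventually (hG.mem_nhds (by simpa using hx))
  refine ⟨fun t => ⟪gradient u (x + t • d), d⟫, ?_, by simp, ?_⟩
  · filter_upwards [hmem] with t ht
    have := ((hu.differentiableOn (by simp)).differentiableAt
      (hG.mem_nhds ht)).hasGradientAt.hasFDerivAt.comp_hasDerivAt t (hline t)
    exact this.congr_deriv (by simp)
  · have h1 : ContDiffOn ℝ 1 (fderiv ℝ u) G := hu.fderiv_of_isOpen hG (by norm_cast)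
    have h2 : DifferentiableAt ℝ (gradient u) x :=
      (InnerProductSpace.toDual ℝ E2).symm.differentiableAt.comp x
        ((h1.differentiableOn (by simp)).differentiableAt (hG.mem_nhds hx))
    have h3 : HasDerivAt (fun t : ℝ => gradient u (x + t • d)) (fderiv ℝ (gradient u) x d) 0 := by
      have := HasFDerivAt.comp_hasDerivAt (l := gradient u) (l' := fderiv ℝ (gradient u) x)
        (0 : ℝ) (by simpa using h2.hasFDerivAt) (hline 0)
      simpa [Function.comp_def] using this
    simpa using h3.inner ℝ (hasDerivAt_const (0 : ℝ) d)

/-- First and second order conditions at a maximum of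
`(w x - w y) ^ k - C * ‖x - y‖ ^ k` along a pair of parallel lines. -/
lemma conditions_of_two_point_max {w : E2 → ℝ} {x y d : E2} {a b k C x1 x2 y1 y2 : ℝ}
    (hx : HasJet (fun t : ℝ => w (x + t • (a • d))) x1 x2)
    (hy : HasJet (fun t : ℝ => w (y + t • (b • d))) y1 y2)
    (hxy : x ≠ y) (hZ : 0 < w x - w y)
    (hmax : ∀ᶠ t : ℝ in 𝓝 0, 0 < w (x + t • (a • d)) - w (y + t • (b • d)) →
      (w (x + t • (a • d)) - w (y + t • (b • d))) ^ k -
        C * (‖x + t • (a • d) - (y + t • (b • d))‖ ^ 2) ^ (k / 2) ≤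
      (w x - w y) ^ k - C * (‖x - y‖ ^ 2) ^ (k / 2)) :
    k * (w x - w y) ^ (k - 1) * (x1 - y1) =
        C * (k / 2 * (‖x - y‖ ^ 2) ^ (k / 2 - 1) * (2 * (a - b) * ⟪x - y, d⟫)) ∧
      k * (k - 1) * (w x - w y) ^ (k - 2) * (x1 - y1) ^ 2 +
        k * (w x - w y) ^ (k - 1) * (x2 - y2) ≤
        C * (k / 2 * (k / 2 - 1) * (‖x - y‖ ^ 2) ^ (k / 2 - 2) *
          (2 * (a - b) * ⟪x - y, d⟫) ^ 2 +
        k / 2 * (‖x - y‖ ^ 2) ^ (k / 2 - 1) * (2 * ((a - b) ^ 2 * ‖d‖ ^ 2))) := by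
  have hs : 0 < ‖x - y‖ ^ 2 := by
    have := norm_pos_iff.2 (sub_ne_zero.2 hxy); positivity
  have hnorm : ∀ t : ℝ, ‖x + t • (a • d) - (y + t • (b • d))‖ ^ 2 =
      ‖x - y‖ ^ 2 + 2 * (a - b) * ⟪x - y, d⟫ * t + (a - b) ^ 2 * ‖d‖ ^ 2 * t ^ 2 := by
    intro t
    rw [show x + t • (a • d) - (y + t • (b • d)) = (x - y) + (t * (a - b)) • d by module,
      norm_add_sq_real, inner_smul_right, norm_smul, mul_pow, Real.norm_eq_abs, sq_abs]
    ring
  have hZt := hx.sub hy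
  have h1 := hZt.rpow (by simpa using hZ) k
  have h2 := ((HasJet.quadratic (‖x - y‖ ^ 2) (2 * (a - b) * ⟪x - y, d⟫)
    ((a - b) ^ 2 * ‖d‖ ^ 2)).rpow (by simpa using hs) (k / 2)).const_mul C
  have hpos : ∀ᶠ t : ℝ in 𝓝 0, 0 < w (x + t • (a • d)) - w (y + t • (b • d)) :=
    hZt.continuousAt.eventually (lt_mem_nhds (by simpa using hZ))
  have h3 := (h1.sub h2).nonpos_of_isLocalMax (by
    filter_upwards [hmax, hpos] with t h h'
    have := h h'
    rw [hnorm] at this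
    simpa using this)
  simp only [zero_smul, add_zero, mul_zero, zero_pow two_ne_zero] at h3
  exact ⟨by linarith [h3.1], by linarith [h3.2]⟩

/-- The first and second order conditions at an off-diagonal maximum of a pair of solutions are
incompatible. -/
lemma two_point_algebra {p k A Y Z s S C γ b1 b2 b3 b4 : ℝ} (hp : 2 < p) (hk0 : 0 < k)
    (hk : (p - 1) * (1 - k) > 1) (hZ : 0 < Z) (hs : 0 < s) (hγ0 : 0 < γ)
    (hAγ : A * γ = C * S) (hZk : C * (S * s) < A * Z)
    (hex : (Y + Z) * ((p - 1) * b1 + b2) = γ ^ 2 * s ^ 2)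
    (hey : Y ^ 2 * ((p - 1) * b3 + b4) = Y * (γ ^ 2 * s ^ 2))
    (h1 : k * (k - 1) * (A / Z) * (Z * γ * s) ^ 2 + k * A * ((Y + Z) ^ 2 * b1 - Y ^ 2 * b3) ≤
      C * (k / 2 * (k / 2 - 1) * (S / s) * (2 * Z * s) ^ 2 + k / 2 * S * (2 * (Z ^ 2 * s))))
    (h2 : k * (k - 1) * (A / Z) * (Z * γ * 0) ^ 2 + k * A * ((Y + Z) ^ 2 * b2 - Y ^ 2 * b4) ≤
      C * (k / 2 * (k / 2 - 1) * (S / s) * (2 * Z * 0) ^ 2 + k / 2 * S * (2 * (Z ^ 2 * s)))) :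
    False := by
  have h1' : k * ((k - 1) * A * Z * γ ^ 2 * s ^ 2 + A * ((Y + Z) ^ 2 * b1 - Y ^ 2 * b3) -
      C * S * Z ^ 2 * s * (k - 1)) ≤ 0 := by
    refine le_trans (le_of_eq ?_) (sub_nonpos.2 h1)
    field_simp
    ring
  have h2' : k * (A * ((Y + Z) ^ 2 * b2 - Y ^ 2 * b4) - C * S * Z ^ 2 * s) ≤ 0 := by
    refine le_trans (le_of_eq ?_) (sub_nonpos.2 h2)
    field_simp
    ring
  have h1'' := nonpos_of_mul_nonpos_right h1' hk0
  have h2'' := nonpos_of_mul_nonpos_right h2' hk0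
  have hsum : A * ((p - 1) * ((Y + Z) ^ 2 * b1 - Y ^ 2 * b3) + ((Y + Z) ^ 2 * b2 - Y ^ 2 * b4)) =
      A * Z * γ ^ 2 * s ^ 2 := by
    linear_combination A * (Y + Z) * hex - A * hey
  have hfin : Z * s * ((A * γ ^ 2 * s - C * S * Z) * (1 - (p - 1) * (1 - k))) ≤ 0 := by
    have := mul_nonneg (by linarith : (0 : ℝ) ≤ p - 1) (neg_nonneg.2 h1'')
    linarith
  have hfin' := nonpos_of_mul_nonpos_right hfin (by positivity)
  have hlt : A * γ ^ 2 * s - C * S * Z < 0 := by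
    have : A * γ ^ 2 * s - C * S * Z = γ * (C * (S * s) - A * Z) := by
      linear_combination (γ * s + Z) * hAγ
    rw [this]
    exact mul_neg_of_pos_of_neg hγ0 (by linarith)
  exact absurd (mul_pos_of_neg_of_neg hlt (by linarith : 1 - (p - 1) * (1 - k) < 0)) hfin'.not_gt

/-- The maximum principle for pairs of points. -/
lemma no_two_point_max {w : E2 → ℝ} {x y gx : E2} {gy : E2} {bx yb : E2 → ℝ} {p k C : ℝ}
    (hp : 2 < p) (hk0 : 0 < k) (hk : (p - 1) * (1 - k) > 1) (hC : 0 < C)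
    (hx : ∀ (c : ℝ) (d : E2), HasJet (fun t : ℝ => w (x + t • (c • d))) (c * ⟪gx, d⟫) (c ^ 2 * bx d))
    (hy : ∀ d : E2, HasJet (fun t : ℝ => w (y + t • (w y • d))) (w y * ⟪gy, d⟫) (w y ^ 2 * yb d))
    (hwx : ∀ (e : E2) (g : ℝ), gx = g • e →
      w x * ((p - 1) * bx e + bx (quarterTurn e)) = g ^ 2 * ‖e‖ ^ 4)
    (hwy : w y ≠ 0 → ∀ (e : E2) (g : ℝ), gy = g • e →
      w y * ((p - 1) * yb e + yb (quarterTurn e)) = g ^ 2 * ‖e‖ ^ 4)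
    (hZ : 0 < w x - w y) (hZk : C * (‖x - y‖ ^ 2) ^ (k / 2) < (w x - w y) ^ k)
    (hmax : ∀ (a b : ℝ) (d : E2), b = 0 ∨ b = w y →
      ∀ᶠ t : ℝ in 𝓝 0, 0 < w (x + t • (a • d)) - w (y + t • (b • d)) →
      (w (x + t • (a • d)) - w (y + t • (b • d))) ^ k -
        C * (‖x + t • (a • d) - (y + t • (b • d))‖ ^ 2) ^ (k / 2) ≤
      (w x - w y) ^ k - C * (‖x - y‖ ^ 2) ^ (k / 2)) : False := by
  have hxy : x ≠ y := by rintro rfl; simp at hZ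
  have hs : 0 < ‖x - y‖ ^ 2 := by
    have := norm_pos_iff.2 (sub_ne_zero.2 hxy); positivity
  have hfst : ∀ d, _ := fun d => (conditions_of_two_point_max (a := 1) (b := 0) (hx 1 d)
    (by simpa using HasJet.const (w y)) hxy hZ (hmax 1 0 d (Or.inl rfl))).1
  have hsnd : ∀ d, _ := fun d => conditions_of_two_point_max (hx (w x) d) (hy d) hxy hZ
    (hmax (w x) (w y) d (Or.inr rfl))
  generalize hX : w x = X at *
  generalize hY : w y = Y at *
  obtain ⟨Z, rfl⟩ : ∃ Z, X = Y + Z := ⟨X - Y, by ring⟩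
  simp only [add_sub_cancel_left] at *
  set ξ := x - y with hξ
  set s := ‖ξ‖ ^ 2 with hsdef
  set A := Z ^ (k - 1) with hA
  have hA0 : 0 < A := by positivity
  have hZ2 : Z ^ (k - 2) = A / Z := by
    rw [hA, ← Real.rpow_sub_one hZ.ne']; ring_nf
  have hZ0 : Z ^ k = A * Z := by
    rw [hA, Real.rpow_sub_one hZ.ne']; field_simp
  have hs2 : s ^ (k / 2 - 2) = s ^ (k / 2 - 1) / s := by
    rw [← Real.rpow_sub_one hs.ne']; ring_nf
  have hs0 : s ^ (k / 2) = s ^ (k / 2 - 1) * s := by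
    rw [Real.rpow_sub_one hs.ne']; field_simp
  have hS0 : 0 < C * s ^ (k / 2 - 1) := by positivity
  rw [hZ0, hs0] at hZk
  simp only [hZ2, hs2] at hsnd
  generalize s ^ (k / 2 - 1) = S at *
  clear hZ2 hZ0 hs2 hs0 hmax
  have hgx : gx = (C * S / A) • ξ := by
    refine ext_inner_right ℝ fun d => ?_
    have := hfst d
    rw [inner_smul_left, conj_trivial]
    field_simp
    apply mul_left_cancel₀ hk0.ne'
    linear_combination this
  set γ := C * S / A with hγ
  have hAγ : A * γ = C * S := by rw [hγ]; field_simp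
  have hγ0 : 0 < γ := by positivity
  have hgy : Y ≠ 0 → gy = γ • ξ := by
    intro hY0
    refine ext_inner_right ℝ fun d => ?_
    have := (hsnd d).1
    rw [hgx] at this
    rw [inner_smul_left, conj_trivial] at this ⊢
    apply mul_left_cancel₀ (mul_ne_zero (mul_ne_zero hk0.ne' hA0.ne') hY0)
    linear_combination (k * Z * ⟪ξ, d⟫) * hAγ - this
  have hcomb : ∀ d, (Y + Z) * ⟪gx, d⟫ - Y * ⟪gy, d⟫ = Z * γ * ⟪ξ, d⟫ := by
    intro d
    by_cases hY0 : Y = 0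
    · simp [hY0, hgx, inner_smul_left]; ring
    · rw [hgx, hgy hY0, inner_smul_left, conj_trivial]; ring
  have hex := hwx ξ γ hgx
  have hey : Y ^ 2 * ((p - 1) * yb ξ + yb (quarterTurn ξ)) = Y * (γ ^ 2 * s ^ 2) := by
    by_cases hY0 : Y = 0
    · simp [hY0]
    · linear_combination Y * hwy hY0 ξ γ (hgy hY0)
  have h1 := (hsnd ξ).2
  have h2 := (hsnd (quarterTurn ξ)).2
  rw [hcomb] at h1 h2
  rw [inner_quarterTurn, norm_sq_quarterTurn] at h2
  rw [real_inner_self_eq_norm_sq] at h1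
  rw [← hsdef] at h1 h2
  generalize bx ξ = b1 at *
  generalize bx (quarterTurn ξ) = b2 at *
  generalize yb ξ = b3 at *
  generalize yb (quarterTurn ξ) = b4 at *
  rw [show ‖ξ‖ ^ 4 = s ^ 2 by rw [hsdef]; ring] at hex
  exact two_point_algebra hp hk0 hk hZ hs (by positivity) hAγ hZk hex hey h1 h2

lemma closure_diff_subset {Ω K : Set E2} (hΩ : IsOpen Ω) :
    closure (Ω \ K) ⊆ (Ω \ K) ∪ frontier Ω ∪ frontier K := by
  intro x hx
  by_cases h1 : x ∈ Ω
  · by_cases h2 : x ∈ K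
    · refine Or.inr ?_
      rw [frontier_eq_closure_inter_closure]
      exact ⟨subset_closure h2, closure_mono (fun y hy => hy.2) hx⟩
    · exact Or.inl (Or.inl ⟨h1, h2⟩)
  · refine Or.inl (Or.inr ?_)
    rw [hΩ.frontier_eq]
    exact ⟨closure_mono sdiff_subset hx, h1⟩

/-- The transform `(1 - u) ^ ((p - 1) / (p - 2))`, which turns the radial potential of a point
into the distance to that point. -/
def profile (p : ℝ) (u : E2 → ℝ) (x : E2) : ℝ := (1 - u x) ^ ((p - 1) / (p - 2))

/-- `u` is the `p`-potential of the convex ring `Ω \ K`. -/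
structure IsPPotential (p : ℝ) (Ω K : Set E2) (u : E2 → ℝ) : Prop where
  two_lt : 2 < p
  isOpen : IsOpen Ω
  isBounded : Bornology.IsBounded Ω
  convex : Convex ℝ Ω
  isCompact : IsCompact K
  subset : K ⊆ Ω
  one_le_dist : ∀ z ∈ frontier Ω, ∀ k ∈ K, 1 ≤ dist z k
  continuousOn : ContinuousOn u (closure (Ω \ K))
  outer : ∀ x ∈ frontier Ω, u x = 0
  inner : ∀ x ∈ frontier K, u x = 1
  contDiffOn : ContDiffOn ℝ (⊤ : ℕ∞) u (Ω \ K)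
  gradient_ne : ∀ x ∈ Ω \ K, gradient u x ≠ 0
  pharmonic : ∀ x ∈ Ω \ K, (p - 2) * lapInf u x + ‖gradient u x‖ ^ 2 * lap u x = 0

namespace IsPPotential

variable {p : ℝ} {Ω K : Set E2} {u : E2 → ℝ} {x y z : E2}

lemma isOpen_diff (h : IsPPotential p Ω K u) : IsOpen (Ω \ K) := h.isOpen.sdiff h.isCompact.isClosed

lemma isCompact_closure (h : IsPPotential p Ω K u) : IsCompact (closure (Ω \ K)) :=
  (h.isBounded.subset sdiff_subset).isCompact_closure

lemma cases_of_mem_closure (h : IsPPotential p Ω K u) (hx : x ∈ closure (Ω \ K)) :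
    x ∈ Ω \ K ∨ x ∈ frontier Ω ∨ x ∈ frontier K := by
  simpa [or_assoc] using closure_diff_subset h.isOpen hx

lemma frontier_subset (h : IsPPotential p Ω K u) : frontier K ⊆ K := h.isCompact.isClosed.frontier_subset

lemma jet (h : IsPPotential p Ω K u) (hx : x ∈ Ω \ K) (d : E2) :
    HasJet (fun t : ℝ => u (x + t • d)) ⟪gradient u x, d⟫ ⟪fderiv ℝ (gradient u) x d, d⟫ :=
  hasJet_line h.isOpen_diff h.contDiffOn hx d

lemma eventually_mem (h : IsPPotential p Ω K u) (hx : x ∈ Ω \ K) (d : E2) :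
    ∀ᶠ t : ℝ in 𝓝 0, x + t • d ∈ Ω \ K := by
  have : ContinuousAt (fun t : ℝ => x + t • d) 0 := by fun_prop
  exact this.eventually (h.isOpen_diff.mem_nhds (by simpa using hx))

lemma not_isLocalExtr (h : IsPPotential p Ω K u) (hx : x ∈ Ω \ K) : ¬ IsLocalExtr u x := by
  intro he
  apply h.gradient_ne x hx
  rw [gradient, he.fderiv_eq_zero, map_zero]

lemma lt_one (h : IsPPotential p Ω K u) (hx : x ∈ Ω \ K) : u x < 1 := by
  obtain ⟨m, hm, hmax⟩ := h.isCompact_closure.exists_isMaxOn ⟨x, subset_closure hx⟩ h.continuousOn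
  have hloc : ∀ y ∈ Ω \ K, u y ≠ u m := fun y hy he => h.not_isLocalExtr hy <| Or.inr <| by
    filter_upwards [h.isOpen_diff.mem_nhds hy] with z hz
    rw [he]
    exact hmax (subset_closure hz)
  have hle : u x ≤ u m := hmax (subset_closure hx)
  have hlt := lt_of_le_of_ne hle (hloc x hx)
  rcases h.cases_of_mem_closure hm with h1 | h1 | h1
  · exact absurd rfl (hloc m h1)
  · rw [h.outer m h1] at hlt; linarith
  · rwa [h.inner m h1] at hlt

lemma pos (h : IsPPotential p Ω K u) (hx : x ∈ Ω \ K) : 0 < u x := by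
  obtain ⟨m, hm, hmin⟩ := h.isCompact_closure.exists_isMinOn ⟨x, subset_closure hx⟩ h.continuousOn
  have hloc : ∀ y ∈ Ω \ K, u m ≠ u y := fun y hy he => h.not_isLocalExtr hy <| Or.inl <| by
    filter_upwards [h.isOpen_diff.mem_nhds hy] with z hz
    rw [← he]
    exact hmin (subset_closure hz)
  have hle : u m ≤ u x := hmin (subset_closure hx)
  have hlt := lt_of_le_of_ne hle (hloc x hx)
  rcases h.cases_of_mem_closure hm with h1 | h1 | h1
  · exact absurd rfl (hloc m h1)
  · rwa [h.outer m h1] at hlt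
  · rw [h.inner m h1] at hlt; linarith

lemma mem_Icc (h : IsPPotential p Ω K u) (hx : x ∈ closure (Ω \ K)) : u x ∈ Icc 0 1 := by
  rcases h.cases_of_mem_closure hx with h1 | h1 | h1
  · exact ⟨(h.pos h1).le, (h.lt_one h1).le⟩
  · simp [h.outer x h1]
  · simp [h.inner x h1]

lemma ball_subset (h : IsPPotential p Ω K u) (hx : x ∈ K) : ball x 1 ⊆ Ω := by
  refine (convex_ball x 1).isPreconnected.subset_of_closure_inter_subset h.isOpen
    ⟨x, mem_ball_self one_pos, h.subset hx⟩ fun a ha => ?_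
  by_contra haΩ
  have := h.one_le_dist a (h.isOpen.frontier_eq ▸ ⟨ha.1, haΩ⟩) x hx
  have := mem_ball.1 ha.2
  linarith

/-- A supporting line of `Ω`, at distance at least one from `K`. -/
lemma exists_support (h : IsPPotential p Ω K u) (hz : z ∈ frontier Ω) :
    ∃ ν : E2, ‖ν‖ = 1 ∧ (∀ x ∈ closure Ω, 0 ≤ ⟪ν, z - x⟫) ∧ ∀ x ∈ K, 1 ≤ ⟪ν, z - x⟫ := by
  have hzΩ : z ∉ Ω := by
    rw [h.isOpen.frontier_eq] at hz
    exact hz.2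
  obtain ⟨f, hf⟩ := geometric_hahn_banach_open_point h.convex h.isOpen hzΩ
  obtain ⟨a, ha⟩ : Ω.Nonempty := by
    rw [nonempty_iff_ne_empty]
    rintro rfl
    simp at hz
  set m := (InnerProductSpace.toDual ℝ E2).symm f with hm
  have hfm : ∀ v, f v = ⟪m, v⟫ := fun v => by simp [hm]
  have hm0 : m ≠ 0 := by
    intro h0
    have := hf a ha
    simp [hfm, h0] at this
  have hnorm : 0 < ‖m‖ := norm_pos_iff.2 hm0
  have hν : ‖(‖m‖⁻¹ • m)‖ = 1 := by
    rw [norm_smul, norm_inv, norm_norm, inv_mul_cancel₀ hnorm.ne']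
  have hpos : ∀ x ∈ Ω, 0 < ⟪‖m‖⁻¹ • m, z - x⟫ := by
    intro x hx
    have := hf x hx
    rw [hfm, hfm] at this
    rw [inner_smul_left, conj_trivial, inner_sub_right]
    exact mul_pos (by positivity) (by linarith)
  refine ⟨‖m‖⁻¹ • m, hν, ?_, ?_⟩
  · have hcl : IsClosed {x : E2 | 0 ≤ ⟪‖m‖⁻¹ • m, z - x⟫} :=
      isClosed_le continuous_const (by fun_prop)
    exact closure_minimal (fun x hx => (hpos x hx).le) hcl
  · intro x hx
    generalize ‖m‖⁻¹ • m = ν at *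
    refine le_of_forall_lt_imp_le_of_dense fun t ht => ?_
    rcases le_or_gt t 0 with ht0 | ht0
    · exact ht0.trans (hpos x (h.subset hx)).le
    · have := hpos (x + t • ν) (h.ball_subset hx (by
        simp [norm_smul, hν, abs_of_pos ht0, ht]))
      rw [← sub_sub, inner_sub_right, inner_smul_right, real_inner_self_eq_norm_sq, hν] at this
      linarith

/-- The distance to a supporting line is an upper barrier. -/
lemma le_dist (h : IsPPotential p Ω K u) (hz : z ∈ frontier Ω) (hy : y ∈ Ω \ K) : u y ≤ dist z y := by
  obtain ⟨ν, hν, hν0, hν1⟩ := h.exists_support hz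
  have hcs : ∀ x, ⟪ν, z - x⟫ ≤ dist z x := fun x => by
    simpa [hν, dist_eq_norm] using real_inner_le_norm ν (z - x)
  obtain ⟨R, hR⟩ : ∃ R, ∀ x ∈ closure Ω, ⟪ν, z - x⟫ ≤ R := by
    obtain ⟨R, hR⟩ := (isBounded_closure_iff.2 h.isBounded).subset_closedBall z
    exact ⟨R, fun x hx => (hcs x).trans (by simpa [dist_comm] using hR hx)⟩
  refine le_trans ?_ (hcs y)
  have hsub : closure (Ω \ K) ⊆ closure Ω := closure_mono sdiff_subset
  suffices hε : ∀ ε > 0, u y ≤ ⟪ν, z - y⟫ + ε * (⟪ν, z - y⟫ * (R - ⟪ν, z - y⟫)) by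
    have hlim : Tendsto (fun ε : ℝ => ⟪ν, z - y⟫ + ε * (⟪ν, z - y⟫ * (R - ⟪ν, z - y⟫))) (𝓝[>] 0)
        (𝓝 ⟪ν, z - y⟫) := by
      have : ContinuousAt
        (fun ε : ℝ => ⟪ν, z - y⟫ + ε * (⟪ν, z - y⟫ * (R - ⟪ν, z - y⟫))) 0 := by fun_prop
      simpa using this.tendsto.mono_left nhdsWithin_le_nhds
    exact ge_of_tendsto hlim (eventually_mem_nhdsWithin.mono fun ε hε' => hε ε hε')
  intro ε hε
  obtain ⟨m, hm, hmax⟩ := h.isCompact_closure.exists_isMaxOn ⟨y, subset_closure hy⟩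
    (h.continuousOn.sub (g := fun x => ⟪ν, z - x⟫ + ε * (⟪ν, z - x⟫ * (R - ⟪ν, z - x⟫)))
      (by fun_prop))
  have hmax' : ∀ x ∈ closure (Ω \ K),
      u x - (⟪ν, z - x⟫ + ε * (⟪ν, z - x⟫ * (R - ⟪ν, z - x⟫))) ≤
      u m - (⟪ν, z - m⟫ + ε * (⟪ν, z - m⟫ * (R - ⟪ν, z - m⟫))) := fun x hx => hmax hx
  suffices hm' : u m ≤ ⟪ν, z - m⟫ + ε * (⟪ν, z - m⟫ * (R - ⟪ν, z - m⟫)) by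
    have := hmax' y (subset_closure hy)
    linarith
  have hextra : 0 ≤ ε * (⟪ν, z - m⟫ * (R - ⟪ν, z - m⟫)) :=
    mul_nonneg hε.le (mul_nonneg (hν0 m (hsub hm)) (sub_nonneg.2 (hR m (hsub hm))))
  rcases h.cases_of_mem_closure hm with h1 | h1 | h1
  · exfalso
    have hcond : ∀ d : E2, _ := fun d =>
      ((h.jet h1 d).sub (HasJet.quadratic
        (⟪ν, z - m⟫ + ε * (⟪ν, z - m⟫ * (R - ⟪ν, z - m⟫)))
        (-⟪ν, d⟫ * (1 + ε * (R - 2 * ⟪ν, z - m⟫))) (-ε * ⟪ν, d⟫ ^ 2))).nonpos_of_isLocalMax (by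
          filter_upwards [h.eventually_mem h1 d] with t ht
          have := hmax' _ (subset_closure ht)
          have hl : ⟪ν, z - (m + t • d)⟫ = ⟪ν, z - m⟫ - t * ⟪ν, d⟫ := by
            rw [← sub_sub, inner_sub_right, inner_smul_right]
          rw [hl] at this
          simp only [zero_smul, add_zero]
          linarith)
    set g := -(1 + ε * (R - 2 * ⟪ν, z - m⟫)) with hg
    have hgrad : gradient u m = g • ν := by
      refine ext_inner_right ℝ fun d => ?_
      rw [inner_smul_left, conj_trivial]
      linarith [(hcond d).1]
    have hfr := pharmonic_frame (h.gradient_ne m h1) hgrad (h.pharmonic m h1)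
    have h2 := (hcond ν).2
    have h3 := (hcond (quarterTurn ν)).2
    rw [real_inner_self_eq_norm_sq, hν] at h2
    rw [inner_quarterTurn] at h3
    have hp := h.two_lt
    nlinarith
  · rw [h.outer m h1]
    linarith [hν0 m (hsub hm)]
  · rw [h.inner m h1]
    linarith [hν1 m (h.frontier_subset h1)]

lemma exponent_pos (h : IsPPotential p Ω K u) : 1 < (p - 1) / (p - 2) := by
  have := h.two_lt
  rw [lt_div_iff₀ (by linarith)]
  linarith

lemma exists_profile_jet (h : IsPPotential p Ω K u) (hx : x ∈ Ω \ K) :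
    ∃ (g : E2) (b : E2 → ℝ),
      (∀ (c : ℝ) (d : E2), HasJet (fun t : ℝ => profile p u (x + t • (c • d)))
        (c * ⟪g, d⟫) (c ^ 2 * b d)) ∧
      ∀ (e : E2) (γ : ℝ), g = γ • e →
        profile p u x * ((p - 1) * b e + b (quarterTurn e)) = γ ^ 2 * ‖e‖ ^ 4 := by
  have hv : 0 < 1 - u x := sub_pos.2 (h.lt_one hx)
  have hp := h.two_lt
  have hp2 : p - 2 ≠ 0 := by linarith
  have hq := h.exponent_pos
  have hqp : (p - 1) * ((p - 1) / (p - 2) - 1) = (p - 1) / (p - 2) := by field_simp; ring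
  unfold profile
  generalize (p - 1) / (p - 2) = q at *
  refine ⟨(-(q * (1 - u x) ^ (q - 1))) • gradient u x,
    fun d => q * (q - 1) * (1 - u x) ^ (q - 2) * ⟪gradient u x, d⟫ ^ 2 -
      q * (1 - u x) ^ (q - 1) * ⟪fderiv ℝ (gradient u) x d, d⟫, fun c d => ?_, fun e γ he => ?_⟩
  · have := ((HasJet.const 1).sub (h.jet hx (c • d))).rpow (by simpa using hv) q
    simp only [zero_smul, add_zero] at this
    convert this using 1
    · simp only [inner_smul_left, inner_smul_right, conj_trivial]; ring
    · simp only [map_smul, inner_smul_left, inner_smul_right, conj_trivial]; ring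
  · have hA : 0 < (1 - u x) ^ (q - 1) := by positivity
    have hq1 : (1 - u x) ^ q = (1 - u x) ^ (q - 1) * (1 - u x) := by
      rw [Real.rpow_sub_one hv.ne']; field_simp
    have hq2 : (1 - u x) ^ (q - 2) = (1 - u x) ^ (q - 1) / (1 - u x) := by
      rw [← Real.rpow_sub_one hv.ne']; ring_nf
    rw [hq1, hq2]
    generalize (1 - u x) ^ (q - 1) = A at *
    obtain ⟨g, hg, rfl⟩ : ∃ g, gradient u x = g • e ∧ γ = -(q * A) * g := by
      refine ⟨(-(q * A))⁻¹ * γ, ?_, ?_⟩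
      · rw [mul_smul, ← he, inv_smul_smul₀]
        have : 0 < q * A := by positivity
        linarith
      · field_simp
    have hfr := pharmonic_frame (h.gradient_ne x hx) hg (h.pharmonic x hx)
    simp only [hg, inner_smul_left, inner_quarterTurn, real_inner_self_eq_norm_sq, conj_trivial]
    field_simp
    linear_combination (g ^ 2 * ‖e‖ ^ 4) * hqp - (1 - u x) * hfr

lemma profile_of_frontier_inner (h : IsPPotential p Ω K u) (hx : x ∈ frontier K) : profile p u x = 0 := by
  have := h.exponent_pos
  rw [profile, h.inner x hx, sub_self, Real.zero_rpow (by linarith)]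

lemma profile_of_frontier_outer (h : IsPPotential p Ω K u) (hx : x ∈ frontier Ω) : profile p u x = 1 := by
  simp [profile, h.outer x hx]

lemma profile_mem_Icc (h : IsPPotential p Ω K u) (hx : x ∈ closure (Ω \ K)) : profile p u x ∈ Icc 0 1 := by
  have := h.mem_Icc hx
  have hq := h.exponent_pos
  exact ⟨Real.rpow_nonneg (by linarith [this.2]) _,
    Real.rpow_le_one (by linarith [this.2]) (by linarith [this.1]) (by linarith)⟩

lemma continuousOn_profile (h : IsPPotential p Ω K u) : ContinuousOn (profile p u) (closure (Ω \ K)) := by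
  have hq := h.exponent_pos
  exact (continuousOn_const.sub h.continuousOn).rpow_const fun x _ => Or.inr (by linarith)

lemma one_sub_profile_le (h : IsPPotential p Ω K u) (hz : z ∈ frontier Ω) (hy : y ∈ Ω \ K) :
    1 - profile p u y ≤ (p - 1) / (p - 2) * dist z y := by
  have h1 := h.le_dist hz hy
  have hq := h.exponent_pos
  have h2 := one_add_mul_self_le_rpow_one_add (s := -u y) (by linarith [h.lt_one hy]) hq.le
  rw [← sub_eq_add_neg] at h2
  rw [profile]
  nlinarith [mul_le_mul_of_nonneg_left h1 (by linarith : 0 ≤ (p - 1) / (p - 2))]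

lemma mem_diff_of_lt_profile (h : IsPPotential p Ω K u) (hx : x ∈ closure (Ω \ K)) (hy : y ∈ closure (Ω \ K))
    (hlt : (p - 1) / (p - 2) * dist x y < profile p u x - profile p u y) :
    x ∈ Ω \ K ∧ (y ∈ Ω \ K ∨ y ∈ frontier K) := by
  have hq := h.exponent_pos
  have hd : 0 ≤ (p - 1) / (p - 2) * dist x y := mul_nonneg (by linarith) dist_nonneg
  have hx1 := h.profile_mem_Icc hx
  have hy1 := h.profile_mem_Icc hy
  have hyΩ : y ∉ frontier Ω := fun hyf => by
    rw [h.profile_of_frontier_outer hyf] at hlt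
    linarith [hx1.2]
  have hy' : y ∈ Ω \ K ∨ y ∈ frontier K := by
    rcases h.cases_of_mem_closure hy with h1 | h1 | h1
    exacts [Or.inl h1, absurd h1 hyΩ, Or.inr h1]
  refine ⟨?_, hy'⟩
  rcases h.cases_of_mem_closure hx with h1 | h1 | h1
  · exact h1
  · exfalso
    rw [h.profile_of_frontier_outer h1] at hlt
    rcases hy' with h2 | h2
    · linarith [h.one_sub_profile_le h1 h2]
    · have := h.one_le_dist x h1 y (h.frontier_subset h2)
      nlinarith [hy1.1]
  · exfalso
    rw [h.profile_of_frontier_inner h1] at hlt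
    linarith [hy1.1]

/-- The transformed potential is Lipschitz with constant `(p - 1) / (p - 2)`. -/
lemma profile_sub_le (h : IsPPotential p Ω K u) (hx : x ∈ closure (Ω \ K)) (hy : y ∈ closure (Ω \ K)) :
    profile p u x - profile p u y ≤ (p - 1) / (p - 2) * dist x y := by
  have hp := h.two_lt
  have hq := h.exponent_pos
  obtain ⟨k, hk0, hk⟩ : ∃ k : ℝ, 0 < k ∧ (p - 1) * (1 - k) > 1 := by
    refine ⟨(p - 2) / (2 * (p - 1)), by apply div_pos <;> linarith, ?_⟩
    have : p - 1 ≠ 0 := by linarith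
    have : (p - 1) * (1 - (p - 2) / (2 * (p - 1))) = p / 2 := by field_simp; ring
    linarith
  have hC : 0 < ((p - 1) / (p - 2)) ^ k := by positivity
  have hdist : ∀ a b : E2, ((p - 1) / (p - 2)) ^ k * (‖a - b‖ ^ 2) ^ (k / 2) =
      ((p - 1) / (p - 2) * dist a b) ^ k := fun a b => by
    rw [Real.mul_rpow (by linarith) dist_nonneg, dist_eq_norm, ← Real.rpow_natCast,
      ← Real.rpow_mul (norm_nonneg _)]
    congr 2
    push_cast
    ring
  by_contra! hlt
  set F : E2 × E2 → ℝ := fun P => (max (profile p u P.1 - profile p u P.2) 0) ^ k -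
    ((p - 1) / (p - 2)) ^ k * (‖P.1 - P.2‖ ^ 2) ^ (k / 2) with hF
  have hFc : ContinuousOn F (closure (Ω \ K) ×ˢ closure (Ω \ K)) := by
    refine ContinuousOn.sub ?_ ?_
    · refine ContinuousOn.rpow_const ?_ fun _ _ => Or.inr hk0.le
      refine ContinuousOn.sup ?_ continuousOn_const
      exact (h.continuousOn_profile.comp continuousOn_fst fun P hP => hP.1).sub
        (h.continuousOn_profile.comp continuousOn_snd fun P hP => hP.2)
    · refine continuousOn_const.mul (ContinuousOn.rpow_const (by fun_prop) fun _ _ => Or.inr ?_)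
      positivity
  obtain ⟨⟨a, b⟩, ⟨ha, hb⟩, hmax⟩ := (h.isCompact_closure.prod h.isCompact_closure).exists_isMaxOn
    ⟨(x, y), hx, hy⟩ hFc
  simp only at ha hb
  have hFpos : 0 < F (a, b) := by
    refine lt_of_lt_of_le ?_ (hmax (mk_mem_prod hx hy))
    have h0 : 0 ≤ (p - 1) / (p - 2) * dist x y := mul_nonneg (by linarith) dist_nonneg
    simp only [hF, hdist]
    rw [max_eq_left (by linarith), sub_pos]
    exact Real.rpow_lt_rpow h0 hlt hk0
  have h0 : 0 ≤ (p - 1) / (p - 2) * dist a b := mul_nonneg (by linarith) dist_nonneg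
  have hlt' : (p - 1) / (p - 2) * dist a b < profile p u a - profile p u b := by
    simp only [hF, hdist, sub_pos] at hFpos
    have := (Real.rpow_lt_rpow_iff h0 (le_max_right _ _) hk0).1 hFpos
    exact (lt_max_iff.1 this).resolve_right h0.not_gt
  have hZ : 0 < profile p u a - profile p u b := by linarith
  obtain ⟨haG, hbG⟩ := h.mem_diff_of_lt_profile ha hb hlt'
  obtain ⟨gx, bx, hjx, hex⟩ := h.exists_profile_jet haG
  obtain ⟨gy, yb, hjy, hey⟩ : ∃ (g : E2) (β : E2 → ℝ),
      (∀ d : E2, HasJet (fun t : ℝ => profile p u (b + t • (profile p u b • d)))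
        (profile p u b * ⟪g, d⟫) (profile p u b ^ 2 * β d)) ∧
      (profile p u b ≠ 0 → ∀ (e : E2) (γ : ℝ), g = γ • e →
        profile p u b * ((p - 1) * β e + β (quarterTurn e)) = γ ^ 2 * ‖e‖ ^ 4) := by
    rcases hbG with h1 | h1
    · obtain ⟨g, β, h2, h3⟩ := h.exists_profile_jet h1
      exact ⟨g, β, fun d => h2 _ d, fun _ => h3⟩
    · have h2 := h.profile_of_frontier_inner h1
      exact ⟨0, 0, fun d => by simpa [h2] using HasJet.const 0, fun h3 => absurd h2 h3⟩
  refine no_two_point_max hp hk0 hk hC hjx hjy hex hey hZ ?_ fun α β d hβ => ?_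
  · rw [hdist]
    exact Real.rpow_lt_rpow h0 hlt' hk0
  · have hbev : ∀ᶠ t : ℝ in 𝓝 0, b + t • (β • d) ∈ closure (Ω \ K) := by
      rcases hbG with h1 | h1
      · exact (h.eventually_mem h1 _).mono fun t ht => subset_closure ht
      · have : β = 0 := by rcases hβ with h2 | h2 <;> simp [h2, h.profile_of_frontier_inner h1]
        simp [this, hb]
    filter_upwards [hbev, h.eventually_mem haG (α • d)] with t h1 h2 h3
    have := hmax (mk_mem_prod (subset_closure h2) h1)
    simp only [hF, mem_ofPred_eq] at this
    rwa [max_eq_left h3.le, max_eq_left hZ.le] at this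

lemma norm_gradient_mul_le (h : IsPPotential p Ω K u) (hx : x ∈ Ω \ K) :
    ‖gradient u x‖ * (1 - u x) ^ (1 / (p - 2)) ≤ 1 := by
  have hp := h.two_lt
  have hq := h.exponent_pos
  have hv : 0 < 1 - u x := sub_pos.2 (h.lt_one hx)
  have hlip : ‖fderiv ℝ (profile p u) x‖ ≤ (p - 1) / (p - 2) := by
    refine norm_fderiv_le_of_lip' ℝ (by linarith) ?_
    filter_upwards [h.isOpen_diff.mem_nhds hx] with y hy
    rw [Real.norm_eq_abs, abs_sub_le_iff, ← dist_eq_norm]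
    refine ⟨h.profile_sub_le (subset_closure hy) (subset_closure hx), ?_⟩
    rw [dist_comm]
    exact h.profile_sub_le (subset_closure hx) (subset_closure hy)
  have hdiff := (h.contDiffOn.differentiableOn (by simp)).differentiableAt
    (h.isOpen_diff.mem_nhds hx)
  have hfd := (hdiff.hasFDerivAt.const_sub 1).rpow_const (p := (p - 1) / (p - 2))
    (Or.inl hv.ne')
  have hfd' : fderiv ℝ (profile p u) x = _ := hfd.fderiv
  have he : (p - 1) / (p - 2) - 1 = 1 / (p - 2) := by
    have : p - 2 ≠ 0 := by linarith
    field_simp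
    ring
  have hn : ‖fderiv ℝ u x‖ = ‖gradient u x‖ := by simp [gradient]
  have hA : 0 < (1 - u x) ^ (1 / (p - 2)) := by positivity
  rw [hfd', norm_smul, norm_neg, he, hn, Real.norm_eq_abs, abs_of_pos (by positivity)] at hlip
  have hq0 : 0 < (p - 1) / (p - 2) := by linarith
  exact le_of_mul_le_mul_left (by linarith) hq0

end IsPPotential

/-- **Gradient bound for the `p`-potential.** For every `0 < c < 1` and every `x ∈ G` with
`u_p(x) ≤ c`, one has `|∇u_p(x)| ≤ (1/(1−c))^(1/(p−2))`. -/
theorem gradient_bound_p_potential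
    (p : ℝ) (hp : 2 < p)
    (Ω K G : Set E2) (u : E2 → ℝ)
    (hΩo : IsOpen Ω) (hΩb : Bornology.IsBounded Ω) (hΩconv : Convex ℝ Ω)
    (hKcp : IsCompact K) (hKconv : Convex ℝ K) (hKne : K.Nonempty) (hKΩ : K ⊆ Ω)
    (hG : G = Ω \ K)
    (hdist : sInf (Set.image2 dist (frontier Ω) K) = 1)
    (hu_cont : ContinuousOn u (closure G))
    (hu0 : ∀ x ∈ frontier Ω, u x = 0)
    (hu1 : ∀ x ∈ frontier K, u x = 1)
    (hu_smooth : ContDiffOn ℝ (⊤ : ℕ∞) u G)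
    (hDu_ne : ∀ x ∈ G, gradient u x ≠ 0)
    (hharm : ∀ x ∈ G, (p - 2) * lapInf u x + ‖gradient u x‖ ^ 2 * lap u x = 0) :
    ∀ c : ℝ, 0 < c → c < 1 → ∀ x ∈ G, u x ≤ c →
      ‖gradient u x‖ ≤ (1 / (1 - c)) ^ (1 / (p - 2)) := by
  intro c _ hc1 x hx hxc
  subst hG
  have h : IsPPotential p Ω K u :=
    { two_lt := hp
      isOpen := hΩo
      isBounded := hΩb
      convex := hΩconv
      isCompact := hKcp
      subset := hKΩ
      one_le_dist := fun z hz k hk => by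
        rw [← hdist]
        refine csInf_le ⟨0, ?_⟩ (mem_image2_of_mem hz hk)
        rintro _ ⟨a, -, b, -, rfl⟩
        exact dist_nonneg
      continuousOn := hu_cont
      outer := hu0
      inner := hu1
      contDiffOn := hu_smooth
      gradient_ne := hDu_ne
      pharmonic := hharm }
  have hc : 0 < 1 - c := by linarith
  have hA : 0 < (1 - c) ^ (1 / (p - 2)) := by positivity
  rw [one_div (1 - c), Real.inv_rpow hc.le, ← one_div, le_div_iff₀ hA]
  refine le_trans (mul_le_mul_of_nonneg_left ?_ (norm_nonneg _)) (h.norm_gradient_mul_le hx)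
  exact Real.rpow_le_rpow hc.le (by linarith) (one_div_nonneg.2 (by linarith))
end
end

section
/- One has 0 ≤ u_p(x) ≤ dist(x, ∂Ω) for every x ∈ G. In particular, at every point y ∈ ∂Ω at which ∇u_p extends continuously from G, the extended gradient satisfies |∇u_p(y)| ≤ 1. -/
open Set Metric Filter
open scoped RealInnerProductSpace

noncomputable section

theorem nonpos_of_isLocalMax_of_hasDerivAt {φ φ' : ℝ → ℝ} {a t : ℝ}
    (hφ : ∀ᶠ s in nhds t, HasDerivAt φ (φ' s) s) (hφ' : HasDerivAt φ' a t)
    (hmax : IsLocalMax φ t) : a ≤ 0 := by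
  by_contra! ha
  have hd : deriv φ =ᶠ[nhds t] φ' := hφ.mono fun s hs => hs.deriv
  have hdd : deriv (deriv φ) t = a := by rw [hd.deriv_eq, hφ'.deriv]
  have hmin : IsLocalMin φ t :=
    isLocalMin_of_deriv_deriv_pos (by rwa [hdd]) hmax.deriv_eq_zero hφ.self_of_nhds.continuousAt
  have hconst : φ =ᶠ[nhds t] fun _ => φ t := by
    filter_upwards [hmax, hmin] with s h₁ h₂ using le_antisymm h₁ h₂
  have h0 : deriv (deriv φ) t = 0 := by
    rw [hconst.deriv.deriv_eq]
    simp
  linarith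

theorem hasDerivAt_comp_line {E : Type*} [NormedAddCommGroup E] [InnerProductSpace ℝ E]
    [CompleteSpace E] {u : E → ℝ} {x v : E} {t : ℝ} (hu : DifferentiableAt ℝ u (x + t • v)) :
    HasDerivAt (fun s : ℝ => u (x + s • v)) ⟪gradient u (x + t • v), v⟫ t := by
  have hl : HasDerivAt (fun s : ℝ => x + s • v) v t := by
    simpa using ((hasDerivAt_id t).smul_const v).const_add x
  have h := hu.hasGradientAt.hasFDerivAt.comp_hasDerivAt t hl
  simpa [Function.comp_def] using h

theorem differentiableAt_gradient {E : Type*} [NormedAddCommGroup E] [InnerProductSpace ℝ E]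
    [CompleteSpace E] {u : E → ℝ} {G : Set E} (hG : IsOpen G)
    (hu : ContDiffOn ℝ (⊤ : ℕ∞) u G) {x : E} (hx : x ∈ G) :
    DifferentiableAt ℝ (gradient u) x := by
  have h : ContDiffAt ℝ 2 u x := (hu.contDiffAt (hG.mem_nhds hx)).of_le
    (WithTop.coe_le_coe.2 le_top)
  have h' : ContDiffAt ℝ 1 (fderiv ℝ u) x := h.fderiv_right (by norm_num)
  exact ((InnerProductSpace.toDual ℝ E).symm.toContinuousLinearEquiv.differentiableAt).comp x
    (h'.differentiableAt (by norm_num))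

theorem inner_hessian_le_of_isLocalMax {E : Type*} [NormedAddCommGroup E] [InnerProductSpace ℝ E]
    [CompleteSpace E] {u : E → ℝ} {G : Set E} (hG : IsOpen G)
    (hu : ContDiffOn ℝ (⊤ : ℕ∞) u G) {x : E} (hx : x ∈ G) (n y : E) (δ : ℝ)
    (hmax : IsLocalMax (fun z => u z - ⟪n, y - z⟫ + δ * ‖z‖ ^ 2) x) (v : E) :
    ⟪fderiv ℝ (gradient u) x v, v⟫ ≤ -2 * δ * ‖v‖ ^ 2 := by
  have hline : ∀ t : ℝ, HasDerivAt (fun s : ℝ => x + s • v) v t := fun t => by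
    simpa using ((hasDerivAt_id t).smul_const v).const_add x
  have hcont : Tendsto (fun s : ℝ => x + s • v) (nhds 0) (nhds x) := by
    simpa using (hline 0).continuousAt.tendsto
  have h1 : ∀ᶠ t in nhds (0 : ℝ), HasDerivAt
      (fun s : ℝ => u (x + s • v) - ⟪n, y - (x + s • v)⟫ + δ * ‖x + s • v‖ ^ 2)
      (⟪gradient u (x + t • v), v⟫ + ⟪n, v⟫ + 2 * δ * ⟪x + t • v, v⟫) t := by
    filter_upwards [hcont (hG.mem_nhds hx)] with t ht
    have hd : DifferentiableAt ℝ u (x + t • v) :=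
      (hu.contDiffAt (hG.mem_nhds ht)).differentiableAt (by simp)
    have e1 := hasDerivAt_comp_line hd
    have e2 := (hasDerivAt_const t n).inner ℝ ((hline t).const_sub y)
    have e3 := ((hline t).norm_sq).const_mul δ
    refine ((e1.sub e2).add e3).congr_deriv ?_
    simp [inner_neg_right]
    ring
  have h2 : HasDerivAt
      (fun t : ℝ => ⟪gradient u (x + t • v), v⟫ + ⟪n, v⟫ + 2 * δ * ⟪x + t • v, v⟫)
      (⟪fderiv ℝ (gradient u) x v, v⟫ + 2 * δ * ⟪v, v⟫) 0 := by
    have hg : HasFDerivAt (gradient u) (fderiv ℝ (gradient u) x) (x + (0 : ℝ) • v) := by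
      simpa using (differentiableAt_gradient hG hu hx).hasFDerivAt
    have e1 := (hg.comp_hasDerivAt (0 : ℝ) (hline 0)).inner ℝ (hasDerivAt_const (0 : ℝ) v)
    have e2 := ((hline 0).inner ℝ (hasDerivAt_const (0 : ℝ) v)).const_mul (2 * δ)
    refine ((e1.add_const ⟪n, v⟫).add e2).congr_deriv ?_
    simp
  have h3 := nonpos_of_isLocalMax_of_hasDerivAt h1 h2 (by
    have : IsLocalMax (fun z => u z - ⟪n, y - z⟫ + δ * ‖z‖ ^ 2) (x + (0 : ℝ) • v) := by simpa
    exact this.comp_continuous (g := fun s : ℝ => x + s • v) (hline 0).continuousAt)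
  rw [real_inner_self_eq_norm_sq] at h3
  linarith

/-- A solution of the `p`-Laplace equation with nonvanishing gradient cannot touch a strictly
concave paraboloid from below at an interior point. -/
theorem not_isLocalMax_sub_paraboloid {p : ℝ} (hp : 2 < p) {G : Set E2} (hG : IsOpen G)
    {u : E2 → ℝ} (hu : ContDiffOn ℝ (⊤ : ℕ∞) u G) {x : E2} (hx : x ∈ G)
    (hDu : gradient u x ≠ 0)
    (hharm : (p - 2) * lapInf u x + ‖gradient u x‖ ^ 2 * lap u x = 0)
    (n y : E2) {δ : ℝ} (hδ : 0 < δ) :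
    ¬ IsLocalMax (fun z => u z - ⟪n, y - z⟫ + δ * ‖z‖ ^ 2) x := by
  intro hmax
  have hH := inner_hessian_le_of_isLocalMax hG hu hx n y δ hmax
  have hinf : lapInf u x ≤ -2 * δ * ‖gradient u x‖ ^ 2 := hH _
  have hlap : lap u x ≤ -4 * δ := by
    rw [lap, LinearMap.trace_eq_sum_inner _ (EuclideanSpace.basisFun (Fin 2) ℝ), Fin.sum_univ_two]
    have h0 := hH (EuclideanSpace.basisFun (Fin 2) ℝ 0)
    have h1 := hH (EuclideanSpace.basisFun (Fin 2) ℝ 1)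
    rw [real_inner_comm, OrthonormalBasis.norm_eq_one] at h0 h1
    simp only [ContinuousLinearMap.coe_coe]
    linarith
  have hpos : 0 < ‖gradient u x‖ ^ 2 := by positivity
  nlinarith [mul_le_mul_of_nonneg_left hinf (sub_pos.2 hp).le,
    mul_le_mul_of_nonneg_left hlap hpos.le, mul_pos (sub_pos.2 hp) (mul_pos hδ hpos),
    mul_pos hδ hpos]

theorem exists_mem_frontier_add_smul {E : Type*} [NormedAddCommGroup E] [NormedSpace ℝ E]
    {Ω : Set E} {x v : E} {s : ℝ} (hs : 0 ≤ s) (hx : x ∈ Ω) (hv : x + s • v ∉ Ω) :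
    ∃ t ∈ Icc 0 s, x + t • v ∈ frontier Ω := by
  have hc : IsPreconnected ((fun t : ℝ => x + t • v) '' Icc 0 s) :=
    isPreconnected_Icc.image _ (by fun_prop)
  by_contra! hno
  have hcover : ∀ t ∈ Icc 0 s, x + t • v ∈ interior Ω ∨ x + t • v ∉ closure Ω := fun t ht => by
    by_contra! h
    exact hno t ht ⟨h.2, h.1⟩
  have h0 : (0 : ℝ) ∈ Icc 0 s := ⟨le_rfl, hs⟩
  have h1 : s ∈ Icc 0 s := ⟨hs, le_rfl⟩
  obtain ⟨z, -, hz, hz'⟩ := hc (interior Ω) (closure Ω)ᶜ isOpen_interior isClosed_closure.isOpen_compl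
    (by rintro _ ⟨t, ht, rfl⟩; exact hcover t ht)
    ⟨_, mem_image_of_mem _ h0, (hcover 0 h0).resolve_right fun h =>
      h (subset_closure (by simpa using hx))⟩
    ⟨_, mem_image_of_mem _ h1, (hcover s h1).resolve_left fun h => hv (interior_subset h)⟩
  exact hz' (subset_closure (interior_subset hz))

/-- Supporting half-plane at a boundary point of an open convex set, with unit normal. -/
theorem exists_unit_normal {E : Type*} [NormedAddCommGroup E] [InnerProductSpace ℝ E]
    [CompleteSpace E] {Ω : Set E} (hΩo : IsOpen Ω) (hΩ : Convex ℝ Ω) (hne : Ω.Nonempty)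
    {y : E} (hy : y ∉ Ω) : ∃ n : E, ‖n‖ = 1 ∧ ∀ z ∈ Ω, 0 < ⟪n, y - z⟫ := by
  obtain ⟨f, hf⟩ := geometric_hahn_banach_open_point hΩ hΩo hy
  set m := (InnerProductSpace.toDual ℝ E).symm f with hm
  have hfm : ∀ z, f z = ⟪m, z⟫ := fun z => by simp [hm]
  have hm0 : m ≠ 0 := by
    rintro h
    obtain ⟨z, hz⟩ := hne
    have := hf z hz
    simp [hfm, h] at this
  refine ⟨‖m‖⁻¹ • m, norm_smul_inv_norm hm0, fun z hz => ?_⟩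
  have := hf z hz
  rw [hfm, hfm] at this
  rw [real_inner_smul_left, inner_sub_right]
  have : 0 < ‖m‖ := norm_pos_iff.2 hm0
  exact mul_pos (inv_pos.2 this) (by linarith)

theorem le_add_smul_of_le_inner_gradient {E : Type*} [NormedAddCommGroup E]
    [InnerProductSpace ℝ E] [CompleteSpace E] {u : E → ℝ} {x v : E} {s c : ℝ} (hs : 0 ≤ s)
    (hcont : ContinuousOn (fun t : ℝ => u (x + t • v)) (Icc 0 s))
    (hd : ∀ t ∈ Ioo 0 s, DifferentiableAt ℝ u (x + t • v))
    (hc : ∀ t ∈ Ioo 0 s, c ≤ ⟪gradient u (x + t • v), v⟫) :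
    u x + c * s ≤ u (x + s • v) := by
  have h := (convex_Icc 0 s).mul_sub_le_image_sub_of_le_deriv hcont
    (by
      rw [interior_Icc]
      exact fun t ht => (hasDerivAt_comp_line (hd t ht)).differentiableAt.differentiableWithinAt)
    (C := c) (by
      rw [interior_Icc]
      intro t ht
      rw [(hasDerivAt_comp_line (hd t ht)).deriv]
      exact hc t ht) 0 (by simp [hs]) s (by simp [hs]) hs
  simp at h
  linarith

theorem closure_diff_cases {X : Type*} [TopologicalSpace X] {Ω K : Set X} (hΩ : IsOpen Ω) {z : X}
    (hz : z ∈ closure (Ω \ K)) : z ∈ Ω \ K ∨ z ∈ frontier Ω ∨ z ∈ K ∩ frontier K := by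
  by_cases hzΩ : z ∈ Ω
  · by_cases hzK : z ∈ K
    · refine Or.inr (Or.inr ⟨hzK, subset_closure hzK, fun hi => ?_⟩)
      obtain ⟨w, hw, hw'⟩ := mem_closure_iff.1 hz _ isOpen_interior hi
      exact hw'.2 (interior_subset hw)
    · exact Or.inl ⟨hzΩ, hzK⟩
  · refine Or.inr (Or.inl ?_)
    rw [hΩ.frontier_eq]
    exact ⟨closure_mono sdiff_subset hz, hzΩ⟩

/-- If `u` vanishes on `∂Ω`, and lies between `0` and the distance to each boundary point, then
a boundary limit of `∇u` has norm at most `1`. -/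
theorem norm_gradient_limit_le_one {E : Type*} [NormedAddCommGroup E] [InnerProductSpace ℝ E]
    [CompleteSpace E] {Ω K : Set E} {u : E → ℝ} (hΩo : IsOpen Ω) (hΩ : Convex ℝ Ω)
    (hK : IsClosed K) (hKΩ : K ⊆ Ω) (hcont : ContinuousOn u (closure (Ω \ K)))
    (hu0 : ∀ x ∈ frontier Ω, u x = 0) (hd : DifferentiableOn ℝ u (Ω \ K))
    {y : E} (hy : y ∈ frontier Ω) (hb : ∀ x ∈ Ω \ K, 0 ≤ u x ∧ u x ≤ dist x y)
    {L : E} (hL : Tendsto (gradient u) (nhdsWithin y (Ω \ K)) (nhds L)) : ‖L‖ ≤ 1 := by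
  by_contra! hL1
  have hGo : IsOpen (Ω \ K) := hΩo.sdiff hK
  have hyΩ : y ∈ closure Ω ∧ y ∉ Ω := by rwa [hΩo.frontier_eq] at hy
  obtain ⟨c, hLc, hcL⟩ : ∃ c, ‖L‖ < c ∧ c < ‖L‖ ^ 2 := exists_between (by nlinarith)
  have hev : ∀ᶠ z in nhdsWithin y (Ω \ K), c < ⟪gradient u z, L⟫ := by
    have h : Tendsto (fun z => ⟪gradient u z, L⟫) (nhdsWithin y (Ω \ K)) (nhds ⟪L, L⟫) :=
      hL.inner tendsto_const_nhds
    refine h.eventually_const_lt ?_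
    rwa [real_inner_self_eq_norm_sq]
  have hKy : Kᶜ ∈ nhds y := hK.isOpen_compl.mem_nhds fun h => hyΩ.2 (hKΩ h)
  obtain ⟨r, hr, hball⟩ := Metric.mem_nhds_iff.1
    (inter_mem (mem_nhdsWithin_iff_eventually.1 hev) hKy)
  have hGr : ∀ z ∈ ball y r, z ∈ closure Ω → z ∈ closure (Ω \ K) := fun z hz hzΩ => by
    have := hK.isOpen_compl.inter_closure ⟨(hball hz).2, hzΩ⟩
    rwa [inter_comm] at this
  have hL0 : 0 < ‖L‖ := by linarith
  obtain ⟨s, hs, hsL⟩ : ∃ s > 0, s * ‖L‖ < r / 2 :=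
    ⟨r / (4 * ‖L‖), by positivity, by field_simp; linarith⟩
  have hgrow : ∀ x ∈ Ω, dist x y < r / 2 → ∀ t ∈ Icc 0 s, x + t • L ∈ closure Ω →
      u x + c * t ≤ u (x + t • L) := by
    intro x hx hxy t ht hxt
    have hmem : ∀ τ ∈ Icc 0 t, x + τ • L ∈ ball y r := by
      intro τ hτ
      have h1 : dist (x + τ • L) x ≤ s * ‖L‖ := by
        rw [dist_eq_norm, add_sub_cancel_left, norm_smul, Real.norm_of_nonneg hτ.1]
        exact mul_le_mul_of_nonneg_right (hτ.2.trans ht.2) hL0.le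
      have h2 := dist_triangle (x + τ • L) x y
      rw [mem_ball]
      linarith
    have hin : ∀ τ ∈ Ico 0 t, x + τ • L ∈ Ω := by
      intro τ hτ
      have ht0 : 0 < t := hτ.1.trans_lt hτ.2
      have h := hΩ.combo_interior_closure_mem_interior (x := x) (by rwa [hΩo.interior_eq]) hxt
        (a := 1 - τ / t) (b := τ / t) (sub_pos.2 ((div_lt_one ht0).2 hτ.2))
        (div_nonneg hτ.1 ht0.le) (by ring)
      rw [hΩo.interior_eq] at h
      convert h using 1
      rw [smul_add, smul_smul, div_mul_cancel₀ _ ht0.ne']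
      module
    have hG : ∀ τ ∈ Ioo 0 t, x + τ • L ∈ Ω \ K := fun τ hτ =>
      ⟨hin τ ⟨hτ.1.le, hτ.2⟩, (hball (hmem τ ⟨hτ.1.le, hτ.2.le⟩)).2⟩
    refine le_add_smul_of_le_inner_gradient ht.1 ?_ ?_ ?_
    · refine hcont.comp (by fun_prop) fun τ hτ => hGr _ (hmem τ hτ) ?_
      rcases hτ.2.eq_or_lt with rfl | h
      · exact hxt
      · exact subset_closure (hin τ ⟨hτ.1, h⟩)
    · exact fun τ hτ => hd.differentiableAt (hGo.mem_nhds (hG τ hτ))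
    · exact fun τ hτ => ((hball (hmem τ ⟨hτ.1.le, hτ.2.le⟩)).1 (hG τ hτ)).le
  have hc0 : 0 < c := hL0.trans hLc
  have hxG : ∀ x ∈ Ω, dist x y < r → x ∈ Ω \ K := fun x hx hxy => ⟨hx, (hball hxy).2⟩
  obtain ⟨x, hx, hxy⟩ := Metric.mem_closure_iff.1 hyΩ.1 (min (r / 2) ((c - ‖L‖) * s))
    (lt_min (by linarith) (mul_pos (by linarith) hs))
  rw [dist_comm, lt_min_iff] at hxy
  have hux := (hb x (hxG x hx (by linarith))).1
  have hstay : x + s • L ∈ Ω := by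
    by_contra hns
    obtain ⟨t, ht, hq⟩ := exists_mem_frontier_add_smul hs.le hx hns
    have h := hgrow x hx hxy.1 t ht (frontier_subset_closure hq)
    rw [hu0 _ hq] at h
    have ht0 : t = 0 := by
      by_contra h0
      have := mul_pos hc0 (lt_of_le_of_ne ht.1 (Ne.symm h0))
      linarith
    rw [hΩo.frontier_eq, ht0, zero_smul, add_zero] at hq
    exact hq.2 hx
  have h1 := hgrow x hx hxy.1 s ⟨hs.le, le_rfl⟩ (subset_closure hstay)
  have h2 : dist (x + s • L) y ≤ s * ‖L‖ + dist x y := by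
    refine (dist_triangle _ x y).trans (add_le_add_left (le_of_eq ?_) _)
    rw [dist_eq_norm, add_sub_cancel_left, norm_smul, Real.norm_of_nonneg hs.le]
  have h3 := (hb _ (hxG _ hstay (by linarith))).2
  linarith

/-- One has `0 ≤ u_p(x) ≤ dist(x, ∂Ω)` in `G`; in particular, at every boundary point
`y ∈ ∂Ω` where `∇u_p` extends continuously from `G`, the extended gradient `L`
satisfies `|L| ≤ 1`. -/
theorem p_potential_distance_bound
    (p : ℝ) (hp : 2 < p)
    (Ω K G : Set E2) (u : E2 → ℝ)
    (hΩo : IsOpen Ω) (hΩb : Bornology.IsBounded Ω) (hΩconv : Convex ℝ Ω)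
    (hKcp : IsCompact K) (hKconv : Convex ℝ K) (hKne : K.Nonempty) (hKΩ : K ⊆ Ω)
    (hG : G = Ω \ K)
    (hdist : sInf (Set.image2 dist (frontier Ω) K) = 1)
    (hu_cont : ContinuousOn u (closure G))
    (hu0 : ∀ x ∈ frontier Ω, u x = 0)
    (hu1 : ∀ x ∈ frontier K, u x = 1)
    (hu_smooth : ContDiffOn ℝ (⊤ : ℕ∞) u G)
    (hDu_ne : ∀ x ∈ G, gradient u x ≠ 0)
    (hharm : ∀ x ∈ G, (p - 2) * lapInf u x + ‖gradient u x‖ ^ 2 * lap u x = 0) :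
    (∀ x ∈ G, 0 ≤ u x ∧ u x ≤ infDist x (frontier Ω)) ∧
      ∀ y ∈ frontier Ω, ∀ L : E2,
        Tendsto (gradient u) (nhdsWithin y G) (nhds L) → ‖L‖ ≤ 1 := by
  subst hG
  have hGo : IsOpen (Ω \ K) := hΩo.sdiff hKcp.isClosed
  have hGc : IsCompact (closure (Ω \ K)) := (hΩb.subset sdiff_subset).isCompact_closure
  have hfr : (frontier Ω).Nonempty := by
    by_contra h
    rw [not_nonempty_iff_eq_empty.1 h] at hdist
    simp at hdist
  have hdistK : ∀ q ∈ frontier Ω, ∀ k ∈ K, 1 ≤ dist q k := fun q hq k hk => by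
    rw [← hdist]
    refine csInf_le ⟨0, ?_⟩ (mem_image2_of_mem hq hk)
    rintro _ ⟨a, -, b, -, rfl⟩
    exact dist_nonneg
  have hbdry : ∀ z ∈ closure (Ω \ K), 0 ≤ u z ∨ z ∈ Ω \ K := fun z hz => by
    rcases closure_diff_cases hΩo hz with h | h | h
    · exact Or.inr h
    · exact Or.inl (hu0 z h).ge
    · exact Or.inl (by rw [hu1 z h.2]; norm_num)
  have hnonneg : ∀ x ∈ Ω \ K, 0 ≤ u x := by
    intro x hx
    obtain ⟨m, hm, hmin⟩ := hGc.exists_isMinOn ⟨x, subset_closure hx⟩ hu_cont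
    refine le_trans ?_ (hmin (subset_closure hx))
    refine (hbdry m hm).resolve_right fun h => hDu_ne m h ?_
    have hloc : IsLocalMin u m := hmin.isLocalMin (mem_of_superset (hGo.mem_nhds h) subset_closure)
    simp [gradient, hloc.fderiv_eq_zero]
  have hupper : ∀ x ∈ Ω \ K, ∀ y ∈ frontier Ω, u x ≤ dist x y := by
    intro x hx y hy
    have hyΩ : y ∉ Ω := by
      rw [hΩo.frontier_eq] at hy
      exact hy.2
    obtain ⟨n, hn, hpos⟩ := exists_unit_normal hΩo hΩconv (hKne.mono hKΩ) hyΩ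
    have hpos' : ∀ z ∈ closure Ω, 0 ≤ ⟪n, y - z⟫ := by
      have hcl : IsClosed {z | 0 ≤ ⟪n, y - z⟫} := isClosed_le (by fun_prop) (by fun_prop)
      exact closure_minimal (fun z hz => (hpos z hz).le) hcl
    have hKone : ∀ k ∈ K, 1 ≤ ⟪n, y - k⟫ := by
      intro k hk
      have hout : k + ⟪n, y - k⟫ • n ∉ Ω := fun h => by
        have := hpos _ h
        rw [← sub_sub, inner_sub_right, real_inner_smul_right, real_inner_self_eq_norm_sq, hn]
          at this
        simp at this
      obtain ⟨t, ht, hq⟩ := exists_mem_frontier_add_smul (hpos k (hKΩ hk)).le (hKΩ hk) hout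
      have h := hdistK _ hq k hk
      rw [dist_eq_norm, add_sub_cancel_left, norm_smul, hn, mul_one,
        Real.norm_of_nonneg ht.1] at h
      exact h.trans ht.2
    obtain ⟨R, hR⟩ := hGc.isBounded.exists_norm_le
    have hδ : ∀ δ : ℝ, 0 < δ → u x ≤ ⟪n, y - x⟫ + δ * R ^ 2 := by
      intro δ hδ
      have hgc : ContinuousOn (fun z => u z - ⟪n, y - z⟫ + δ * ‖z‖ ^ 2) (closure (Ω \ K)) :=
        (hu_cont.sub (by fun_prop)).add (by fun_prop)
      obtain ⟨m, hm, hmax⟩ := hGc.exists_isMaxOn ⟨x, subset_closure hx⟩ hgc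
      have hle : u x - ⟪n, y - x⟫ + δ * ‖x‖ ^ 2 ≤ u m - ⟪n, y - m⟫ + δ * ‖m‖ ^ 2 :=
        hmax (subset_closure hx)
      have hmR : δ * ‖m‖ ^ 2 ≤ δ * R ^ 2 := by
        gcongr
        exact hR m hm
      have hx0 : 0 ≤ δ * ‖x‖ ^ 2 := by positivity
      have hum : u m ≤ ⟪n, y - m⟫ := by
        rcases closure_diff_cases hΩo hm with h | h | h
        · exact absurd
            (hmax.isLocalMax (mem_of_superset (hGo.mem_nhds h) subset_closure))
            (not_isLocalMax_sub_paraboloid hp hGo hu_smooth h (hDu_ne m h) (hharm m h) n y hδ)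
        · rw [hu0 m h]
          exact hpos' m (frontier_subset_closure h)
        · rw [hu1 m h.2]
          exact hKone m h.1
      linarith
    have hlim : u x ≤ ⟪n, y - x⟫ := by
      refine ge_of_tendsto (x := nhdsWithin (0 : ℝ) (Ioi 0))
        (f := fun δ => ⟪n, y - x⟫ + δ * R ^ 2) ?_
        (eventually_mem_nhdsWithin.mono fun δ h => hδ δ h)
      have : Continuous fun δ : ℝ => ⟪n, y - x⟫ + δ * R ^ 2 := by fun_prop
      simpa using (this.tendsto 0).mono_left nhdsWithin_le_nhds
    refine hlim.trans ((real_inner_le_norm _ _).trans ?_)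
    rw [hn, one_mul, dist_comm, dist_eq_norm]
  refine ⟨fun x hx => ⟨hnonneg x hx, (le_infDist hfr).2 fun {y} hy => hupper x hx y hy⟩, ?_⟩
  intro y hy L hL
  exact norm_gradient_limit_le_one hΩo hΩconv hKcp.isClosed hKΩ hu_cont hu0
    (hu_smooth.differentiableOn (by simp)) hy
    (fun x hx => ⟨hnonneg x hx, hupper x hx y hy⟩) hL
end
end

section
/- Let B_R = B_R(x₀) ⊆ ℝ² be an open disc, and let f be continuous on closure(B_R), C¹ in B_R with ∫∫_{B_R} |∇f|² dx < ∞, and monotone in the sense of Lebesgue on B_R. Then for every 0 < r < R, (osc_{B_r} f)² · ln(R/r) ≤ π · ∫∫_{B_R} |∇f|² dx, where B_r = B_r(x₀) is the concentric disc. -/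
open Set Metric MeasureTheory
open scoped RealInnerProductSpace

noncomputable section

/-- The oscillation of `f` over a set `S`: `osc_S f = sup_S f − inf_S f`. -/
def osc (f : E2 → ℝ) (S : Set E2) : ℝ := sSup (f '' S) - sInf (f '' S)

lemma osc_mono {f : E2 → ℝ} {S T : Set E2} (hne : S.Nonempty) (hST : S ⊆ T)
    (ha : BddAbove (f '' T)) (hb : BddBelow (f '' T)) : osc f S ≤ osc f T :=
  sub_le_sub (csSup_le_csSup ha (hne.image f) (image_mono hST))
    (csInf_le_csInf hb (hne.image f) (image_mono hST))

lemma osc_nonneg {f : E2 → ℝ} {S : Set E2} (hne : S.Nonempty)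
    (ha : BddAbove (f '' S)) (hb : BddBelow (f '' S)) : 0 ≤ osc f S :=
  sub_nonneg.2 (csInf_le_csSup (hne.image f) hb ha)

/-- The oscillation of a continuous function over a nonempty compact set is attained. -/
lemma exists_osc_eq_sub {f : E2 → ℝ} {S : Set E2} (hS : IsCompact S) (hne : S.Nonempty)
    (hf : ContinuousOn f S) : ∃ p ∈ S, ∃ q ∈ S, osc f S = f p - f q := by
  obtain ⟨p, hp, hp'⟩ := hS.exists_sSup_image_eq hne hf
  obtain ⟨q, hq, hq'⟩ := hS.exists_sInf_image_eq hne hf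
  exact ⟨p, hp, q, hq, by rw [osc, hp', hq']⟩

/-- A periodic `C¹` function satisfies `4 (h α - h β)² ≤ T ∫ h'²`, the integral being taken over
any period. -/
lemma Function.Periodic.four_mul_sub_sq_le {h h' : ℝ → ℝ} {T : ℝ} (hp : Function.Periodic h T)
    (hT : 0 < T) (hd : ∀ t, HasDerivAt h (h' t) t) (hc : Continuous h') (α β s : ℝ) :
    4 * (h α - h β) ^ 2 ≤ T * ∫ t in s..s + T, h' t ^ 2 := by
  have hp' : Function.Periodic (fun t => h' t ^ 2) T := fun t => by
    have h1 : HasDerivAt h (h' (t + T)) t := by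
      simpa only [hp.funext] using (hd (t + T)).comp_add_const t T
    simp only [h1.unique (hd t)]
  rw [hp'.intervalIntegral_add_eq s α]
  obtain ⟨γ, hγ, hγ'⟩ := hp.exists_mem_Ico hT β α
  rw [hγ']
  have hi : ∀ a b, IntervalIntegrable (fun t => |h' t|) volume a b := fun a b =>
    hc.abs.intervalIntegrable a b
  have hv : ∀ a b, a ≤ b → |h b - h a| ≤ ∫ t in a..b, |h' t| := fun a b hab => by
    rw [← intervalIntegral.integral_eq_sub_of_hasDerivAt (fun t _ => hd t)
      (hc.intervalIntegrable a b)]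
    exact intervalIntegral.abs_integral_le_integral_abs hab
  have h1 := hv α γ hγ.1
  have h2 := hv γ (α + T) hγ.2.le
  have h3 := intervalIntegral.integral_add_adjacent_intervals (hi α γ) (hi γ (α + T))
  rw [hp α, abs_sub_comm] at h2
  set D := |h γ - h α| with hD
  have hD2 : (h α - h γ) ^ 2 = D ^ 2 := by rw [hD, sq_abs]; ring
  have h4 : 0 ≤ ∫ t in α..α + T, (|h' t| - 2 * D / T) ^ 2 :=
    intervalIntegral.integral_nonneg (by linarith) fun t _ => sq_nonneg _
  have h5 : ∫ t in α..α + T, (|h' t| - 2 * D / T) ^ 2 =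
      (∫ t in α..α + T, h' t ^ 2) - 2 * (2 * D / T) * (∫ t in α..α + T, |h' t|)
        + T * (2 * D / T) ^ 2 := by
    have : ∀ t, (|h' t| - 2 * D / T) ^ 2 =
        h' t ^ 2 - 2 * (2 * D / T) * |h' t| + (2 * D / T) ^ 2 := fun t => by
      rw [← sq_abs (h' t)]; ring
    simp only [this]
    rw [intervalIntegral.integral_add, intervalIntegral.integral_sub,
      intervalIntegral.integral_const_mul, intervalIntegral.integral_const]
    · simp
    all_goals exact Continuous.intervalIntegrable (by fun_prop) _ _
  have hD0 : 0 ≤ D := abs_nonneg _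
  have h6 : 2 * (2 * D / T) * (2 * D) ≤ 2 * (2 * D / T) * ∫ t in α..α + T, |h' t| := by
    gcongr; linarith
  have h7 : 0 ≤ T * ((∫ t in α..α + T, h' t ^ 2) - 2 * (2 * D / T) * (2 * D)
        + T * (2 * D / T) ^ 2) := mul_nonneg hT.le (by linarith)
  have h8 : T * ((∫ t in α..α + T, h' t ^ 2) - 2 * (2 * D / T) * (2 * D)
        + T * (2 * D / T) ^ 2) = T * (∫ t in α..α + T, h' t ^ 2) - 4 * D ^ 2 := by
    field_simp; ring
  rw [hD2]; linarith

lemma norm_gradient_eq_norm_fderiv (f : E2 → ℝ) (x : E2) : ‖gradient f x‖ = ‖fderiv ℝ f x‖ :=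
  LinearIsometryEquiv.norm_map _ _

lemma measurable_norm_gradient_sq (f : E2 → ℝ) : Measurable fun x => ‖gradient f x‖ ^ 2 := by
  simp only [norm_gradient_eq_norm_fderiv]
  exact (measurable_fderiv ℝ f).norm.pow_const 2

section Circle

variable (e : ℂ ≃ₗᵢ[ℝ] E2) (x₀ : E2)

lemma add_circleMap_mem_sphere {ρ : ℝ} (hρ : 0 ≤ ρ) (θ : ℝ) :
    x₀ + e (circleMap 0 ρ θ) ∈ sphere x₀ ρ := by
  simp [abs_of_nonneg hρ]

lemma exists_add_circleMap_eq {ρ : ℝ} {p : E2} (hp : p ∈ sphere x₀ ρ) :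
    ∃ θ, x₀ + e (circleMap 0 ρ θ) = p := by
  refine ⟨(e.symm (p - x₀)).arg, ?_⟩
  have : ρ = ‖e.symm (p - x₀)‖ := by
    rw [LinearIsometryEquiv.norm_map, ← dist_eq_norm]; exact (mem_sphere.1 hp).symm
  rw [circleMap_zero, this, Complex.norm_mul_exp_arg_mul_I]
  simp

lemma osc_sphere_sq_le {f : E2 → ℝ} {R ρ : ℝ} (hf : ContDiffOn ℝ 1 f (ball x₀ R)) (hρ : 0 < ρ)
    (hρR : ρ < R) :
    4 * osc f (sphere x₀ ρ) ^ 2 ≤ 2 * Real.pi *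
      ∫ θ in -Real.pi..Real.pi, ρ ^ 2 * ‖gradient f (x₀ + e (circleMap 0 ρ θ))‖ ^ 2 := by
  have hsub : sphere x₀ ρ ⊆ ball x₀ R := sphere_subset_ball hρR
  have hmem : ∀ θ, x₀ + e (circleMap 0 ρ θ) ∈ ball x₀ R := fun θ =>
    hsub (add_circleMap_mem_sphere e x₀ hρ.le θ)
  obtain ⟨p, hp, q, hq, hpq⟩ := exists_osc_eq_sub (isCompact_sphere x₀ ρ)
    (NormedSpace.sphere_nonempty.2 hρ.le) (hf.continuousOn.mono hsub)
  obtain ⟨α, rfl⟩ := exists_add_circleMap_eq e x₀ hp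
  obtain ⟨β, rfl⟩ := exists_add_circleMap_eq e x₀ hq
  have hγc : Continuous fun θ => x₀ + e (circleMap 0 ρ θ) := by fun_prop
  have hfc : Continuous fun θ => fderiv ℝ f (x₀ + e (circleMap 0 ρ θ)) :=
    (hf.continuousOn_fderiv_of_isOpen isOpen_ball le_rfl).comp_continuous hγc hmem
  have hγ : ∀ θ, HasDerivAt (fun θ => x₀ + e (circleMap 0 ρ θ))
      (e (circleMap 0 ρ θ * Complex.I)) θ := fun θ =>
    (e.toContinuousLinearEquiv.hasFDerivAt.comp_hasDerivAt θ
      (hasDerivAt_circleMap 0 ρ θ)).const_add x₀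
  have hd : ∀ θ, HasDerivAt (fun θ => f (x₀ + e (circleMap 0 ρ θ)))
      (fderiv ℝ f (x₀ + e (circleMap 0 ρ θ)) (e (circleMap 0 ρ θ * Complex.I))) θ := fun θ =>
    ((hf.differentiableOn one_ne_zero).differentiableAt
      (isOpen_ball.mem_nhds (hmem θ))).hasFDerivAt.comp_hasDerivAt θ (hγ θ)
  have hc : Continuous fun θ =>
      fderiv ℝ f (x₀ + e (circleMap 0 ρ θ)) (e (circleMap 0 ρ θ * Complex.I)) :=
    hfc.clm_apply (by fun_prop)
  have hper : Function.Periodic (fun θ => f (x₀ + e (circleMap 0 ρ θ))) (2 * Real.pi) := fun θ => by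
    simp only [periodic_circleMap 0 ρ θ]
  have key := hper.four_mul_sub_sq_le Real.two_pi_pos hd hc α β (-Real.pi)
  rw [show -Real.pi + 2 * Real.pi = Real.pi by ring] at key
  rw [hpq]
  refine key.trans ?_
  gcongr
  refine intervalIntegral.integral_mono_on (by linarith [Real.pi_pos])
    ((hc.pow 2).intervalIntegrable _ _) ?_ fun θ _ => ?_
  · simp only [norm_gradient_eq_norm_fderiv]
    exact (continuous_const.mul (hfc.norm.pow 2)).intervalIntegrable _ _
  · rw [norm_gradient_eq_norm_fderiv, ← mul_pow, sq_le_sq, abs_of_nonneg (a := ρ * _) (by positivity)]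
    refine ((fderiv ℝ f _).le_opNorm _).trans_eq ?_
    simp [abs_of_pos hρ, mul_comm]

/-- Integration in polar coordinates on the plane. -/
lemma lintegral_eq_lintegral_circleMap {F : E2 → ENNReal} (hF : Measurable F) :
    ∫⁻ x, F x = ∫⁻ ρ in Ioi (0 : ℝ), ∫⁻ θ in Ioo (-Real.pi) Real.pi,
      ENNReal.ofReal ρ * F (x₀ + e (circleMap 0 ρ θ)) := by
  have h1 : ∫⁻ z : ℂ, F (x₀ + e z) = ∫⁻ x, F x := by
    rw [← lintegral_add_left_eq_self F x₀]
    exact e.measurePreserving.lintegral_comp (hF.comp (measurable_const_add x₀))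
  have h2 : ∀ p : ℝ × ℝ, Complex.polarCoord.symm p = circleMap 0 p.1 p.2 := fun p => by
    rw [Complex.polarCoord_symm_apply, circleMap_zero, Complex.exp_mul_I]
    simp
  rw [← h1, ← Complex.lintegral_comp_polarCoord_symm]
  simp only [h2, smul_eq_mul]
  refine setLIntegral_prod _ (Measurable.aemeasurable ?_)
  refine (by fun_prop : Measurable fun p : ℝ × ℝ => ENNReal.ofReal p.1).mul (hF.comp ?_)
  refine Continuous.measurable ?_
  simp only [circleMap_zero]
  fun_prop

end Circle

/-- **Lebesgue's oscillation lemma.** If `f` is continuous on the closed disc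
`closure B_R(x₀)`, `C¹` in `B_R(x₀)` with finite Dirichlet integral, and monotone in the
sense of Lebesgue on `B_R(x₀)`, then for every `0 < r < R`,
`(osc_{B_r} f)² · ln(R/r) ≤ π · ∫∫_{B_R} |∇f|² dx`. -/
theorem lebesgue_oscillation_lemma
    (x₀ : E2) (R : ℝ) (hR : 0 < R) (f : E2 → ℝ)
    (hf_cont : ContinuousOn f (closedBall x₀ R))
    (hf_C1 : ContDiffOn ℝ 1 f (ball x₀ R))
    (hf_int : IntegrableOn (fun x => ‖gradient f x‖ ^ 2) (ball x₀ R))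
    (hf_mono : ∀ r ∈ Ioo (0 : ℝ) R, osc f (sphere x₀ r) = osc f (closedBall x₀ r))
    (r : ℝ) (hr : r ∈ Ioo (0 : ℝ) R) :
    (osc f (ball x₀ r)) ^ 2 * Real.log (R / r) ≤
      Real.pi * ∫ x in ball x₀ R, ‖gradient f x‖ ^ 2 := by
  let e : ℂ ≃ₗᵢ[ℝ] E2 := Complex.orthonormalBasisOneI.repr
  have hr0 : 0 < r := hr.1
  have hbdd : ∀ ρ ≤ R, BddAbove (f '' closedBall x₀ ρ) ∧ BddBelow (f '' closedBall x₀ ρ) :=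
    fun ρ hρ => ⟨(isCompact_closedBall x₀ ρ).bddAbove_image
        (hf_cont.mono (closedBall_subset_closedBall hρ)),
      (isCompact_closedBall x₀ ρ).bddBelow_image
        (hf_cont.mono (closedBall_subset_closedBall hρ))⟩
  have hne : (ball x₀ r).Nonempty := nonempty_ball.2 hr0
  have hosc0 : 0 ≤ osc f (ball x₀ r) :=
    osc_nonneg hne ((hbdd r hr.2.le).1.mono (image_mono ball_subset_closedBall))
      ((hbdd r hr.2.le).2.mono (image_mono ball_subset_closedBall))
  set A := osc f (ball x₀ r) ^ 2 with hA
  have hA0 : 0 ≤ A := sq_nonneg _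
  set G : E2 → ℝ := fun x => ‖gradient f x‖ ^ 2 with hG
  have hGm : Measurable G := measurable_norm_gradient_sq f
  have hcircle : ∀ ρ ∈ Ioo r R, ENNReal.ofReal (A / Real.pi * (1 / ρ)) ≤
      ∫⁻ θ in Ioo (-Real.pi) Real.pi,
        ENNReal.ofReal ρ * (ball x₀ R).indicator (fun x => ENNReal.ofReal (G x))
          (x₀ + e (circleMap 0 ρ θ)) := by
    intro ρ hρ
    have hρ0 : 0 < ρ := hr0.trans hρ.1
    have hmem : ∀ θ, x₀ + e (circleMap 0 ρ θ) ∈ ball x₀ R := fun θ =>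
      sphere_subset_ball hρ.2 (add_circleMap_mem_sphere e x₀ hρ0.le θ)
    have hGc : Continuous fun θ => G (x₀ + e (circleMap 0 ρ θ)) := by
      simp only [hG, norm_gradient_eq_norm_fderiv]
      exact ((hf_C1.continuousOn_fderiv_of_isOpen isOpen_ball le_rfl).comp_continuous
        (by fun_prop) hmem).norm.pow 2
    simp only [indicator_of_mem (hmem _), ← ENNReal.ofReal_mul hρ0.le]
    rw [restrict_Ioo_eq_restrict_Ioc, ← ofReal_integral_eq_lintegral_ofReal
      ((hGc.const_mul ρ).integrableOn_Ioc) (ae_of_all _ fun θ => by positivity),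
      ← intervalIntegral.integral_of_le (by linarith [Real.pi_pos])]
    apply ENNReal.ofReal_le_ofReal
    have h1 := osc_sphere_sq_le e x₀ hf_C1 hρ0 hρ.2
    rw [intervalIntegral.integral_const_mul] at h1 ⊢
    have h2 : A ≤ osc f (sphere x₀ ρ) ^ 2 := by
      rw [hf_mono ρ ⟨hρ0, hρ.2⟩, hA]
      gcongr
      exact osc_mono hne (ball_subset_closedBall.trans (closedBall_subset_closedBall hρ.1.le))
        (hbdd ρ hρ.2.le).1 (hbdd ρ hρ.2.le).2
    rw [div_mul_div_comm, mul_one, div_le_iff₀ (by positivity)]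
    simp only [hG]
    nlinarith
  have hlog : ∫⁻ ρ in Ioo r R, ENNReal.ofReal (A / Real.pi * (1 / ρ)) =
      ENNReal.ofReal (A / Real.pi * Real.log (R / r)) := by
    have hi : IntervalIntegrable (fun ρ => A / Real.pi * (1 / ρ)) volume r R := by
      refine ContinuousOn.intervalIntegrable ?_
      rw [uIcc_of_le hr.2.le]
      exact continuousOn_const.mul (continuousOn_const.div continuousOn_id fun x hx =>
        (hr0.trans_le hx.1).ne')
    rw [← integral_one_div_of_pos hr0 hR, ← intervalIntegral.integral_const_mul,
      intervalIntegral.integral_of_le hr.2.le, ofReal_integral_eq_lintegral_ofReal hi.1,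
      restrict_Ioo_eq_restrict_Ioc]
    filter_upwards [ae_restrict_mem measurableSet_Ioc] with ρ hρ
    have : 0 < ρ := hr0.trans hρ.1
    positivity
  have hmain : ENNReal.ofReal (A / Real.pi * Real.log (R / r)) ≤
      ENNReal.ofReal (∫ x in ball x₀ R, G x) := by
    rw [ofReal_integral_eq_lintegral_ofReal hf_int (ae_of_all _ fun x => by positivity),
      ← lintegral_indicator measurableSet_ball,
      lintegral_eq_lintegral_circleMap e x₀ (hGm.ennreal_ofReal.indicator measurableSet_ball),
      ← hlog]
    exact (setLIntegral_mono' measurableSet_Ioo hcircle).trans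
      (lintegral_mono_set fun ρ hρ => hr0.trans hρ.1)
  rw [ENNReal.ofReal_le_ofReal_iff (integral_nonneg fun x => by positivity), div_mul_eq_mul_div,
    div_le_iff₀ Real.pi_pos] at hmain
  linarith
end
end

section
/- Let p > 2, U ⊆ ℝ² open, u ∈ C²(U), and x ∈ U with ∇u(x) ≠ 0. If (p−2)·Δ∞u(x) + |∇u(x)|²·Δu(x) = 0, then −det D²u(x) = |D²u(x)∇u(x)|²/|∇u(x)|² + (Δu(x))²/(p−2). (Here |D²u∇u|/|∇u| equals |∇|∇u|| wherever ∇u ≠ 0 and u is C².) -/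
open Set Metric
open scoped RealInnerProductSpace

noncomputable section

/-- At a point where `v` is `C²`, the derivative of the gradient is a symmetric operator. -/
theorem ContDiffAt.isSymmetric_fderiv_gradient {F : Type*} [NormedAddCommGroup F]
    [InnerProductSpace ℝ F] [CompleteSpace F] {v : F → ℝ} {x : F} (hv : ContDiffAt ℝ 2 v x) :
    (fderiv ℝ (gradient v) x : F →ₗ[ℝ] F).IsSymmetric := by
  have hd : DifferentiableAt ℝ (fderiv ℝ v) x :=
    (hv.fderiv_right (m := 1) (by norm_num)).differentiableAt one_ne_zero
  have hg : HasFDerivAt (gradient v) _ x :=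
    ((InnerProductSpace.toDual ℝ F).symm.toContinuousLinearEquiv :
      (StrongDual ℝ F) ≃L[ℝ] F).hasFDerivAt.comp x hd.hasFDerivAt
  have key (a b : F) : ⟪fderiv ℝ (gradient v) x a, b⟫ = fderiv ℝ (fderiv ℝ v) x a b := by
    rw [hg.fderiv]
    exact InnerProductSpace.toDual_symm_apply
  intro a b
  rw [ContinuousLinearMap.coe_coe, key, real_inner_comm, key]
  exact hv.isSymmSndFDerivAt (by simp) a b

/-- For a symmetric operator `A` on the plane, Cayley–Hamilton gives
`|Ag|² = tr A ⟨Ag, g⟩ - det A |g|²`. -/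
theorem LinearMap.IsSymmetric.norm_sq_apply_eq_trace_sub_det {A : E2 →ₗ[ℝ] E2}
    (hA : A.IsSymmetric) (g : E2) :
    ‖A g‖ ^ 2 = LinearMap.trace ℝ E2 A * ⟪A g, g⟫ - LinearMap.det A * ‖g‖ ^ 2 := by
  let b := EuclideanSpace.basisFun (Fin 2) ℝ
  have hg : g = g 0 • b 0 + g 1 • b 1 := by
    rw [← Fin.sum_univ_two (fun i => g i • b i)]
    exact (b.sum_repr g).symm
  have hAg (i : Fin 2) : A g i = g 0 * A (b 0) i + g 1 * A (b 1) i := by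
    conv_lhs => rw [hg]
    simp
  have hsymm : A (b 0) 1 = A (b 1) 0 := by
    simpa [b, EuclideanSpace.inner_single_left, EuclideanSpace.inner_single_right]
      using hA (b 0) (b 1)
  have hM (i j : Fin 2) : LinearMap.toMatrix b.toBasis b.toBasis A i j = A (b j) i := by
    simp [LinearMap.toMatrix_apply, b]
  rw [LinearMap.trace_eq_matrix_trace ℝ b.toBasis, ← LinearMap.det_toMatrix b.toBasis,
    Matrix.trace_fin_two, Matrix.det_fin_two, EuclideanSpace.real_norm_sq_eq,
    EuclideanSpace.real_norm_sq_eq]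
  simp only [hM, PiLp.inner_apply, Fin.sum_univ_two, hAg, RCLike.inner_apply, conj_trivial, hsymm]
  ring

/-- At a point where `∇u ≠ 0` and the `p`-Laplace equation holds, one has
`−det D²u = |D²u∇u|²/|∇u|² + (Δu)²/(p−2)`. -/
theorem neg_det_hessian_identity
    (p : ℝ) (hp : 2 < p) (U : Set E2) (hU : IsOpen U) (u : E2 → ℝ)
    (hu : ContDiffOn ℝ 2 u U) (x : E2) (hx : x ∈ U)
    (hne : gradient u x ≠ 0)
    (hharm : (p - 2) * lapInf u x + ‖gradient u x‖ ^ 2 * lap u x = 0) :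
    -LinearMap.det (fderiv ℝ (gradient u) x : E2 →ₗ[ℝ] E2) =
      ‖fderiv ℝ (gradient u) x (gradient u x)‖ ^ 2 / ‖gradient u x‖ ^ 2
        + (lap u x) ^ 2 / (p - 2) := by
  have hA := (hu.contDiffAt (hU.mem_nhds hx)).isSymmetric_fderiv_gradient
  have hCH := hA.norm_sq_apply_eq_trace_sub_det (gradient u x)
  have hg : ‖gradient u x‖ ^ 2 ≠ 0 := pow_ne_zero 2 (norm_ne_zero_iff.mpr hne)
  have hp' : p - 2 ≠ 0 := (sub_pos.mpr hp).ne'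
  change ‖fderiv ℝ (gradient u) x (gradient u x)‖ ^ 2 = lap u x * lapInf u x - _ at hCH
  rw [hCH]
  field_simp
  linear_combination (-lap u x) * hharm
end
end

section
/- There is an absolute constant C with the following property. Let p > 2, let U ⊆ ℝ² be open, and let u ∈ C^∞(U) satisfy ∇u ≠ 0 in U and (p−2)·Δ∞u + |∇u|²·Δu = 0 in U. Then for every ξ ∈ C_c^∞(U): ∫∫_U |∇(|∇u|²)|² ξ² dx + (1/(p−2)) ∫∫_U |∇u|² (Δu)² ξ² dx ≤ C ∫∫_U |∇u|⁴ (|∇ξ|² + |ξ|·‖D²ξ‖) dx, where ‖D²ξ‖ denotes the operator norm of the Hessian of ξ. -/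
open Set Metric MeasureTheory
open scoped RealInnerProductSpace

noncomputable section

/-- The partial derivative `∂ᵢf`. -/
def pd (i : Fin 2) (f : E2 → ℝ) (x : E2) : ℝ :=
  fderiv ℝ f x (EuclideanSpace.single i 1)

lemma gradient_apply (f : E2 → ℝ) (x : E2) (i : Fin 2) : gradient f x i = pd i f x := by
  have h : ⟪gradient f x, EuclideanSpace.single i (1 : ℝ)⟫ = pd i f x := by
    rw [← InnerProductSpace.toDual_apply_apply (𝕜 := ℝ), toDual_gradient]
    rfl
  rw [← h, EuclideanSpace.inner_single_right]
  simp

lemma norm_gradient_sq (f : E2 → ℝ) (x : E2) :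
    ‖gradient f x‖ ^ 2 = pd 0 f x ^ 2 + pd 1 f x ^ 2 := by
  rw [EuclideanSpace.real_norm_sq_eq, Fin.sum_univ_two, gradient_apply, gradient_apply]

lemma ContDiffAt.gradient {f : E2 → ℝ} {x : E2} (hf : ContDiffAt ℝ (⊤ : ℕ∞) f x) :
    ContDiffAt ℝ (⊤ : ℕ∞) (gradient f) x := by
  have h : ContDiffAt ℝ (⊤ : ℕ∞) (fderiv ℝ f) x := hf.fderiv_right (by simp)
  exact (InnerProductSpace.toDual ℝ E2).symm.contDiff.contDiffAt.comp x h

lemma ContDiffAt.pd {f : E2 → ℝ} {x : E2} (hf : ContDiffAt ℝ (⊤ : ℕ∞) f x) (i : Fin 2) :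
    ContDiffAt ℝ (⊤ : ℕ∞) (pd i f) x :=
  (hf.fderiv_right (m := (⊤ : ℕ∞)) (by simp)).clm_apply contDiffAt_const

lemma fderiv_gradient_apply {f : E2 → ℝ} {x : E2} (hf : ContDiffAt ℝ (⊤ : ℕ∞) f x)
    (v : E2) (i : Fin 2) :
    fderiv ℝ (gradient f) x v i = fderiv ℝ (pd i f) x v := by
  have h := (hf.gradient.differentiableAt (by simp)).hasFDerivAt
  have h' : HasFDerivAt (pd i f)
      ((EuclideanSpace.proj i : E2 →L[ℝ] ℝ).comp (fderiv ℝ (gradient f) x)) x := by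
    have := (EuclideanSpace.proj i : E2 →L[ℝ] ℝ).hasFDerivAt.comp x h
    refine this.congr_of_eventuallyEq (Filter.Eventually.of_forall fun y => ?_)
    simp [gradient_apply]
  rw [h'.fderiv]
  simp

lemma pd_comm {f : E2 → ℝ} {x : E2} (hf : ContDiffAt ℝ (⊤ : ℕ∞) f x) (i j : Fin 2) :
    pd i (pd j f) x = pd j (pd i f) x := by
  have hd : DifferentiableAt ℝ (fderiv ℝ f) x :=
    (hf.fderiv_right (m := (⊤ : ℕ∞)) (by simp)).differentiableAt (by simp)
  have key : ∀ i j, pd i (pd j f) x =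
      fderiv ℝ (fderiv ℝ f) x (EuclideanSpace.single i 1) (EuclideanSpace.single j 1) := by
    intro i j
    have := hd.hasFDerivAt.clm_apply (hasFDerivAt_const (EuclideanSpace.single j (1 : ℝ)) x)
    change fderiv ℝ (fun y => fderiv ℝ f y (EuclideanSpace.single j 1)) x _ = _
    rw [this.fderiv]
    simp
  rw [key, key]
  exact (hf.isSymmSndFDerivAt (by
    rw [minSmoothness_of_isRCLikeNormedField]
    exact WithTop.coe_le_coe.2 (le_top : (2 : ℕ∞) ≤ ⊤))) _ _

lemma fderiv_eq_pd (f : E2 → ℝ) (x v : E2) :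
    fderiv ℝ f x v = v 0 * pd 0 f x + v 1 * pd 1 f x := by
  have hv : v = v 0 • EuclideanSpace.single 0 (1 : ℝ) + v 1 • EuclideanSpace.single 1 (1 : ℝ) := by
    ext i
    fin_cases i <;> simp
  conv_lhs => rw [hv]
  simp [pd]

lemma inner_fderiv_gradient {f : E2 → ℝ} {x : E2} (hf : ContDiffAt ℝ (⊤ : ℕ∞) f x) (v : E2) :
    ⟪fderiv ℝ (gradient f) x v, v⟫ =
      pd 0 (pd 0 f) x * v 0 ^ 2 + 2 * pd 0 (pd 1 f) x * (v 0 * v 1)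
        + pd 1 (pd 1 f) x * v 1 ^ 2 := by
  rw [PiLp.inner_apply, Fin.sum_univ_two, fderiv_gradient_apply hf, fderiv_gradient_apply hf,
    fderiv_eq_pd, fderiv_eq_pd, pd_comm hf 1 0]
  simp
  ring

lemma lapInf_eq {f : E2 → ℝ} {x : E2} (hf : ContDiffAt ℝ (⊤ : ℕ∞) f x) :
    lapInf f x = pd 0 (pd 0 f) x * pd 0 f x ^ 2 + 2 * pd 0 (pd 1 f) x * (pd 0 f x * pd 1 f x)
        + pd 1 (pd 1 f) x * pd 1 f x ^ 2 := by
  rw [lapInf, inner_fderiv_gradient hf, gradient_apply, gradient_apply]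

lemma lap_eq {f : E2 → ℝ} {x : E2} (hf : ContDiffAt ℝ (⊤ : ℕ∞) f x) :
    lap f x = pd 0 (pd 0 f) x + pd 1 (pd 1 f) x := by
  rw [lap, LinearMap.trace_eq_sum_inner _ (EuclideanSpace.basisFun (Fin 2) ℝ), Fin.sum_univ_two]
  simp [EuclideanSpace.inner_single_left, fderiv_gradient_apply hf, pd]

section Leibniz

variable {f g : E2 → ℝ} {x : E2}

lemma pd_add (hf : DifferentiableAt ℝ f x) (hg : DifferentiableAt ℝ g x) (i : Fin 2) :
    pd i (fun y => f y + g y) x = pd i f x + pd i g x := by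
  simp [pd, fderiv_fun_add hf hg]

lemma pd_sub (hf : DifferentiableAt ℝ f x) (hg : DifferentiableAt ℝ g x) (i : Fin 2) :
    pd i (fun y => f y - g y) x = pd i f x - pd i g x := by
  simp [pd, fderiv_fun_sub hf hg]

lemma pd_mul (hf : DifferentiableAt ℝ f x) (hg : DifferentiableAt ℝ g x) (i : Fin 2) :
    pd i (fun y => f y * g y) x = f x * pd i g x + g x * pd i f x := by
  simp [pd, fderiv_fun_mul hf hg]

lemma pd_const_mul (c : ℝ) (hf : DifferentiableAt ℝ f x) (i : Fin 2) :
    pd i (fun y => c * f y) x = c * pd i f x := by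
  simp [pd, fderiv_const_mul hf]

lemma pd_sq (hf : DifferentiableAt ℝ f x) (i : Fin 2) :
    pd i (fun y => f y ^ 2) x = 2 * f x * pd i f x := by
  simp only [pow_two, pd_mul hf hf]
  ring

end Leibniz

lemma norm_gradient_norm_gradient_sq {f : E2 → ℝ} {x : E2} (hf : ContDiffAt ℝ (⊤ : ℕ∞) f x) :
    ‖gradient (fun y => ‖gradient f y‖ ^ 2) x‖ ^ 2 =
      4 * ((pd 0 (pd 0 f) x * pd 0 f x + pd 0 (pd 1 f) x * pd 1 f x) ^ 2
        + (pd 0 (pd 1 f) x * pd 0 f x + pd 1 (pd 1 f) x * pd 1 f x) ^ 2) := by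
  have h0 : DifferentiableAt ℝ (pd 0 f) x := (hf.pd 0).differentiableAt (by simp)
  have h1 : DifferentiableAt ℝ (pd 1 f) x := (hf.pd 1).differentiableAt (by simp)
  simp only [norm_gradient_sq]
  rw [pd_add (h0.fun_pow 2) (h1.fun_pow 2), pd_add (h0.fun_pow 2) (h1.fun_pow 2), pd_sq h0, pd_sq h1, pd_sq h0,
    pd_sq h1, pd_comm hf 1 0]
  ring

/-- A component of the vector field `|∇u|²ξ²(D²u∇u - Δu∇u) + 2|∇u|²ξ⟨∇u,∇ξ⟩∇u`, where
`A, B` are the components of `∇u`, `X, Y` those of `∇ξ`, and `H, K` are entries of `D²u`. -/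
def flux (A B Z X Y H K : E2 → ℝ) (x : E2) : ℝ :=
  (A x ^ 2 + B x ^ 2) * Z x ^ 2 * (H x * B x - K x * A x)
    + 2 * ((A x ^ 2 + B x ^ 2) * Z x * (A x * X x + B x * Y x) * A x)

lemma pd_flux {A B Z X Y H K : E2 → ℝ} {x : E2}
    (hA : DifferentiableAt ℝ A x) (hB : DifferentiableAt ℝ B x) (hZ : DifferentiableAt ℝ Z x)
    (hX : DifferentiableAt ℝ X x) (hY : DifferentiableAt ℝ Y x) (hH : DifferentiableAt ℝ H x)
    (hK : DifferentiableAt ℝ K x) (i : Fin 2) :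
    pd i (flux A B Z X Y H K) x =
      (2 * A x * pd i A x + 2 * B x * pd i B x) * Z x ^ 2 * (H x * B x - K x * A x)
      + (A x ^ 2 + B x ^ 2) * (2 * Z x * pd i Z x) * (H x * B x - K x * A x)
      + (A x ^ 2 + B x ^ 2) * Z x ^ 2 *
        (H x * pd i B x + B x * pd i H x - K x * pd i A x - A x * pd i K x)
      + 2 * ((2 * A x * pd i A x + 2 * B x * pd i B x) * Z x * (A x * X x + B x * Y x) * A x
        + (A x ^ 2 + B x ^ 2) * pd i Z x * (A x * X x + B x * Y x) * A x
        + (A x ^ 2 + B x ^ 2) * Z x *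
          (A x * pd i X x + X x * pd i A x + B x * pd i Y x + Y x * pd i B x) * A x
        + (A x ^ 2 + B x ^ 2) * Z x * (A x * X x + B x * Y x) * pd i A x) := by
  unfold flux
  rw [pd_add (by fun_prop) (by fun_prop), pd_mul (by fun_prop) (by fun_prop),
    pd_mul (by fun_prop) (by fun_prop), pd_add (by fun_prop) (by fun_prop), pd_sq hA, pd_sq hB,
    pd_sq hZ, pd_sub (by fun_prop) (by fun_prop), pd_mul hH hB, pd_mul hK hA,
    pd_const_mul _ (by fun_prop), pd_mul (by fun_prop) hA, pd_mul (by fun_prop) (by fun_prop),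
    pd_mul (by fun_prop) hZ, pd_add (by fun_prop) (by fun_prop), pd_mul hA hX, pd_mul hB hY,
    pd_add (by fun_prop) (by fun_prop), pd_sq hA, pd_sq hB]
  ring

/-- The pointwise form of the estimate; `(g₀, g₁)` is the gradient and `(a, b; b, c)` the Hessian
of the solution, `q = p - 2`, and `z, (z₀, z₁), (z₀₀, z₀₁; z₀₁, z₁₁)` is the 2-jet of the cutoff. -/
lemma pointwise_estimate {q g₀ g₁ a b c z z₀ z₁ z₀₀ z₀₁ z₁₁ N : ℝ} (hq : 0 < q)
    (h : q * (a * g₀ ^ 2 + 2 * b * (g₀ * g₁) + c * g₁ ^ 2) + (g₀ ^ 2 + g₁ ^ 2) * (a + c) = 0)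
    (hN : |z₀₀ * g₀ ^ 2 + 2 * z₀₁ * (g₀ * g₁) + z₁₁ * g₁ ^ 2| ≤ N * (g₀ ^ 2 + g₁ ^ 2)) :
    4 * ((a * g₀ + b * g₁) ^ 2 + (b * g₀ + c * g₁) ^ 2) * z ^ 2
      + 1 / q * ((g₀ ^ 2 + g₁ ^ 2) * (a + c) ^ 2 * z ^ 2) ≤
    2 * (-4 * (g₀ ^ 2 + g₁ ^ 2) * (a * c - b ^ 2) * z ^ 2
          + 4 * (g₀ ^ 2 + g₁ ^ 2) * z * ((a * g₀ + b * g₁) * z₀ + (b * g₀ + c * g₁) * z₁)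
          + 4 * (g₀ * (a * g₀ + b * g₁) + g₁ * (b * g₀ + c * g₁)) * z * (g₀ * z₀ + g₁ * z₁)
          + 2 * (g₀ ^ 2 + g₁ ^ 2) * (g₀ * z₀ + g₁ * z₁) ^ 2
          + 2 * (g₀ ^ 2 + g₁ ^ 2) * z *
            (z₀₀ * g₀ ^ 2 + 2 * z₀₁ * (g₀ * g₁) + z₁₁ * g₁ ^ 2))
      + 20 * ((g₀ ^ 2 + g₁ ^ 2) ^ 2 * (z₀ ^ 2 + z₁ ^ 2 + |z| * N)) := by
  set Zgg := z₀₀ * g₀ ^ 2 + 2 * z₀₁ * (g₀ * g₁) + z₁₁ * g₁ ^ 2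
  obtain ⟨w, hw⟩ : ∃ w, w = g₀ ^ 2 + g₁ ^ 2 := ⟨_, rfl⟩
  obtain ⟨P, hP⟩ : ∃ P, P = a * g₀ + b * g₁ := ⟨_, rfl⟩
  obtain ⟨R, hR⟩ : ∃ R, R = b * g₀ + c * g₁ := ⟨_, rfl⟩
  have hw0 : 0 ≤ w := by rw [hw]; positivity
  have hT0 : 0 ≤ 1 / q * (w * (a + c) ^ 2 * z ^ 2) := by positivity
  have hgH : 1 / q * (w * (a + c)) = -(g₀ * P + g₁ * R) := by
    rw [hw, hP, hR]
    field_simp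
    linear_combination h
  have hdet : -w * (a * c - b ^ 2) = P ^ 2 + R ^ 2 + 1 / q * (w * (a + c)) * (a + c) := by
    rw [hgH, hw, hP, hR]
    ring
  have hZ : -(w ^ 2 * (|z| * N)) ≤ w * (z * Zgg) := by
    have h1 : |z * Zgg| ≤ |z| * (N * w) := by
      rw [abs_mul, hw]
      gcongr
    nlinarith [mul_le_mul_of_nonneg_left (abs_le.1 h1).1 hw0]
  have hN0 : 0 ≤ w ^ 2 * (|z| * N) := by
    have h1 : 0 ≤ N * w := hw ▸ (abs_nonneg _).trans hN
    have h2 : w ^ 2 * (|z| * N) = w * |z| * (N * w) := by ring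
    rw [h2]
    positivity
  have hS1 : 0 ≤ (z * P + 2 * w * z₀) ^ 2 + (z * R + 2 * w * z₁) ^ 2 := by positivity
  have hS2 : 0 ≤ (z * P + 2 * (g₀ * z₀ + g₁ * z₁) * g₀) ^ 2
      + (z * R + 2 * (g₀ * z₀ + g₁ * z₁) * g₁) ^ 2 := by positivity
  have hCS : w * (g₀ * z₀ + g₁ * z₁) ^ 2 ≤ w ^ 2 * (z₀ ^ 2 + z₁ ^ 2) := by
    have h1 : (g₀ * z₀ + g₁ * z₁) ^ 2 ≤ w * (z₀ ^ 2 + z₁ ^ 2) := by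
      rw [hw]
      nlinarith [sq_nonneg (g₀ * z₁ - g₁ * z₀)]
    nlinarith [mul_le_mul_of_nonneg_left h1 hw0]
  have hW0 : 0 ≤ w * (g₀ * z₀ + g₁ * z₁) ^ 2 := by positivity
  have hX0 : 0 ≤ w ^ 2 * (z₀ ^ 2 + z₁ ^ 2) := by positivity
  rw [← hw, ← hP, ← hR]
  have hS2' : 0 ≤ z ^ 2 * (P ^ 2 + R ^ 2) + 4 * (g₀ * P + g₁ * R) * z * (g₀ * z₀ + g₁ * z₁)
      + 4 * (w * (g₀ * z₀ + g₁ * z₁) ^ 2) := by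
    rw [hw]
    linarith [hS2]
  have hdet' : -w * (a * c - b ^ 2) * z ^ 2
      = (P ^ 2 + R ^ 2) * z ^ 2 + 1 / q * (w * (a + c) ^ 2 * z ^ 2) := by
    rw [hdet]
    ring
  linarith

lemma integrable_pd {V : E2 → ℝ} (hV : ContDiff ℝ 1 V) (hc : HasCompactSupport V) (i : Fin 2) :
    Integrable (pd i V) :=
  ((hV.continuous_fderiv (by simp)).clm_apply continuous_const).integrable_of_hasCompactSupport
    (hc.fderiv_apply ℝ _)

lemma integral_pd_eq_zero {V : E2 → ℝ} (hV : ContDiff ℝ 1 V) (hc : HasCompactSupport V)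
    (i : Fin 2) : ∫ x, pd i V x = 0 := by
  have h := integral_mul_fderiv_eq_neg_fderiv_mul_of_integrable (μ := volume)
    (f := fun _ : E2 => (1 : ℝ)) (g := V) (v := EuclideanSpace.single i 1)
    (by simp) (by simpa only [one_mul] using! integrable_pd hV hc i)
    (by simpa using hV.continuous.integrable_of_hasCompactSupport hc)
    (fun x _ => differentiableAt_const _) (fun x _ => hV.differentiable (by simp) x)
  simpa [pd] using h

lemma integrable_of_continuousOn_of_eq_zero {F : E2 → ℝ} {U K : Set E2} (hK : IsCompact K)
    (hKU : K ⊆ U) (hF : ContinuousOn F U) (h0 : ∀ x ∉ K, F x = 0) : Integrable F :=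
  (integrableOn_iff_integrable_of_support_subset fun x hx => by
    by_contra hxK
    exact hx (h0 x hxK)).1 ((hF.mono hKU).integrableOn_compact hK)

section Flux

variable {A B Z X Y H K : E2 → ℝ}

lemma support_flux_subset : Function.support (flux A B Z X Y H K) ⊆ Function.support Z := by
  intro x hx hZ
  exact hx (by simp [flux, hZ])

lemma contDiff_flux
    (h : ∀ x ∈ tsupport Z, ∀ f ∈ [A, B, Z, X, Y, H, K], ContDiffAt ℝ (⊤ : ℕ∞) f x) :
    ContDiff ℝ 1 (flux A B Z X Y H K) := by
  refine contDiff_iff_contDiffAt.2 fun x => ?_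
  by_cases hx : x ∈ tsupport (flux A B Z X Y H K)
  swap
  · exact contDiffAt_const.congr_of_eventuallyEq (notMem_tsupport_iff_eventuallyEq.1 hx)
  have h' := h x (closure_mono support_flux_subset hx)
  simp only [List.mem_cons, List.not_mem_nil, or_false, forall_eq_or_imp, forall_eq] at h'
  obtain ⟨hA, hB, hZ, hX, hY, hH, hK⟩ := h'
  refine ContDiffAt.of_le (n := ((⊤ : ℕ∞) : WithTop ℕ∞)) ?_ (mod_cast le_top)
  unfold flux
  fun_prop

end Flux

/-- **Caccioppoli-type estimate (Lemma 5.1 of Koch–Zhang–Zhou, `p`-version).**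
There is an absolute constant `C` such that for every solution `u` of the `p`-Laplace
equation with non-vanishing gradient on an open set `U ⊆ ℝ²` and every `ξ ∈ C_c^∞(U)`:
`∫∫ |∇(|∇u|²)|²ξ² + (1/(p−2)) ∫∫ |∇u|²(Δu)²ξ² ≤ C ∫∫ |∇u|⁴(|∇ξ|² + |ξ|·‖D²ξ‖)`. -/
theorem caccioppoli_estimate_pLaplace :
    ∃ C : ℝ, 0 < C ∧
      ∀ (p : ℝ), 2 < p → ∀ (U : Set E2), IsOpen U →
      ∀ (u : E2 → ℝ), ContDiffOn ℝ (⊤ : ℕ∞) u U →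
        (∀ x ∈ U, gradient u x ≠ 0) →
        (∀ x ∈ U, (p - 2) * lapInf u x + ‖gradient u x‖ ^ 2 * lap u x = 0) →
      ∀ (ξ : E2 → ℝ), ContDiff ℝ (⊤ : ℕ∞) ξ → HasCompactSupport ξ → tsupport ξ ⊆ U →
        (∫ x in U, ‖gradient (fun y => ‖gradient u y‖ ^ 2) x‖ ^ 2 * (ξ x) ^ 2)
          + (1 / (p - 2)) * ∫ x in U, ‖gradient u x‖ ^ 2 * (lap u x) ^ 2 * (ξ x) ^ 2
        ≤ C * ∫ x in U, ‖gradient u x‖ ^ 4 *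
            (‖gradient ξ x‖ ^ 2 + |ξ x| * ‖fderiv ℝ (gradient ξ) x‖) := by
  
  refine ⟨20, by norm_num, ?_⟩
  intro p hp U hU u hu _ hpde ξ hξ hcs hsub
  have hq : 0 < p - 2 := by linarith
  have hu' : ∀ x ∈ U, ContDiffAt ℝ (⊤ : ℕ∞) u x := fun x hx => hu.contDiffAt (hU.mem_nhds hx)
  have hξ' : ∀ x, ContDiffAt ℝ (⊤ : ℕ∞) ξ x := fun x => hξ.contDiffAt
  set V₀ := flux (pd 0 u) (pd 1 u) ξ (pd 0 ξ) (pd 1 ξ) (pd 1 (pd 0 u)) (pd 1 (pd 1 u)) with hV₀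
  set V₁ := flux (pd 1 u) (pd 0 u) ξ (pd 1 ξ) (pd 0 ξ) (pd 0 (pd 1 u)) (pd 0 (pd 0 u)) with hV₁
  have hV₀d : ContDiff ℝ 1 V₀ := contDiff_flux fun x hx => by
    have hux := hu' x (hsub hx)
    simp only [List.mem_cons, List.not_mem_nil, or_false, forall_eq_or_imp, forall_eq]
    exact ⟨hux.pd 0, hux.pd 1, hξ' x, (hξ' x).pd 0, (hξ' x).pd 1, (hux.pd 0).pd 1,
      (hux.pd 1).pd 1⟩
  have hV₁d : ContDiff ℝ 1 V₁ := contDiff_flux fun x hx => by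
    have hux := hu' x (hsub hx)
    simp only [List.mem_cons, List.not_mem_nil, or_false, forall_eq_or_imp, forall_eq]
    exact ⟨hux.pd 1, hux.pd 0, hξ' x, (hξ' x).pd 1, (hξ' x).pd 0, (hux.pd 1).pd 0,
      (hux.pd 0).pd 0⟩
  have hV₀c : HasCompactSupport V₀ := hcs.mono support_flux_subset
  have hV₁c : HasCompactSupport V₁ := hcs.mono support_flux_subset
  have hpdV : ∀ (V : E2 → ℝ), Function.support V ⊆ Function.support ξ → ∀ i, ∀ x ∉ U,
      pd i V x = 0 := fun V hV i x hx => by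
    have hxV : x ∉ tsupport V := fun h => hx (hsub (closure_mono hV h))
    simp [pd, fderiv_of_notMem_tsupport (𝕜 := ℝ) hxV]
  have hdiv : ∫ x in U, (pd 0 V₀ x + pd 1 V₁ x) = 0 := by
    rw [setIntegral_eq_integral_of_forall_compl_eq_zero fun x hx => by
        rw [hpdV V₀ support_flux_subset 0 x hx, hpdV V₁ support_flux_subset 1 x hx, add_zero],
      integral_add (integrable_pd hV₀d hV₀c 0) (integrable_pd hV₁d hV₁c 1),
      integral_pd_eq_zero hV₀d hV₀c, integral_pd_eq_zero hV₁d hV₁c, add_zero]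
  have hdivi : Integrable fun x => pd 0 V₀ x + pd 1 V₁ x :=
    (integrable_pd hV₀d hV₀c 0).add (integrable_pd hV₁d hV₁c 1)
  have hξ0 : ∀ x ∉ tsupport ξ, ξ x = 0 := fun x hx => image_eq_zero_of_notMem_tsupport hx
  have hgradc : ContinuousOn (fun x => ‖gradient u x‖) U := fun x hx =>
    (hu' x hx).gradient.continuousAt.norm.continuousWithinAt
  have hξc : ContinuousOn ξ U := hξ.continuous.continuousOn
  have hlapc : ContinuousOn (lap u) U := by
    refine ContinuousOn.congr (f := fun x => pd 0 (pd 0 u) x + pd 1 (pd 1 u) x) ?_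
      fun x hx => lap_eq (hu' x hx)
    exact fun x hx => ((((hu' x hx).pd 0).pd 0).continuousAt.add
      (((hu' x hx).pd 1).pd 1).continuousAt).continuousWithinAt
  have hnormc : ContinuousOn (fun x => ‖gradient (fun y => ‖gradient u y‖ ^ 2) x‖) U :=
    fun x hx => ((hu' x hx).gradient.norm_sq ℝ).gradient.continuousAt.norm.continuousWithinAt
  have hgξ : ContDiff ℝ (⊤ : ℕ∞) (gradient ξ) :=
    contDiff_iff_contDiffAt.2 fun x => (hξ' x).gradient
  have hgξc : ContinuousOn (gradient ξ) U := hgξ.continuous.continuousOn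
  have hHξc : ContinuousOn (fderiv ℝ (gradient ξ)) U :=
    (hgξ.continuous_fderiv (by simp)).continuousOn
  have h1 : Integrable fun x =>
      ‖gradient (fun y => ‖gradient u y‖ ^ 2) x‖ ^ 2 * (ξ x) ^ 2 :=
    integrable_of_continuousOn_of_eq_zero hcs hsub (by fun_prop) fun x hx => by simp [hξ0 x hx]
  have h2 : Integrable fun x => ‖gradient u x‖ ^ 2 * (lap u x) ^ 2 * (ξ x) ^ 2 :=
    integrable_of_continuousOn_of_eq_zero hcs hsub (by fun_prop) fun x hx => by simp [hξ0 x hx]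
  have h3 : Integrable fun x => ‖gradient u x‖ ^ 4 *
      (‖gradient ξ x‖ ^ 2 + |ξ x| * ‖fderiv ℝ (gradient ξ) x‖) :=
    integrable_of_continuousOn_of_eq_zero hcs hsub (by fun_prop) fun x hx => by
      simp [hξ0 x hx, gradient, fderiv_of_notMem_tsupport (𝕜 := ℝ) hx]
  rw [← integral_const_mul, ← integral_add h1.integrableOn (h2.const_mul _).integrableOn]
  calc
    _ ≤ ∫ x in U, (2 * (pd 0 V₀ x + pd 1 V₁ x) + 20 * (‖gradient u x‖ ^ 4 *
        (‖gradient ξ x‖ ^ 2 + |ξ x| * ‖fderiv ℝ (gradient ξ) x‖))) := by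
      refine setIntegral_mono_on (h1.add (h2.const_mul _)).integrableOn
        ((hdivi.const_mul 2).add (h3.const_mul 20)).integrableOn hU.measurableSet fun x hx => ?_
      have hux := hu' x hx
      have hξx := hξ' x
      have hd : ∀ {f : E2 → ℝ}, ContDiffAt ℝ (⊤ : ℕ∞) f x → DifferentiableAt ℝ f x :=
        fun hf => hf.differentiableAt (by simp)
      have hN : |pd 0 (pd 0 ξ) x * pd 0 u x ^ 2 + 2 * pd 0 (pd 1 ξ) x * (pd 0 u x * pd 1 u x)
          + pd 1 (pd 1 ξ) x * pd 1 u x ^ 2| ≤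
          ‖fderiv ℝ (gradient ξ) x‖ * (pd 0 u x ^ 2 + pd 1 u x ^ 2) := by
        rw [← gradient_apply u, ← gradient_apply u, ← inner_fderiv_gradient hξx]
        refine (abs_real_inner_le_norm _ _).trans ?_
        rw [gradient_apply, gradient_apply, ← norm_gradient_sq, pow_two, ← mul_assoc]
        gcongr
        exact ContinuousLinearMap.le_opNorm _ _
      have he := hpde x hx
      rw [lapInf_eq hux, lap_eq hux, norm_gradient_sq] at he
      have hpt := pointwise_estimate (z := ξ x) (z₀ := pd 0 ξ x) (z₁ := pd 1 ξ x) hq he hN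
      have h4 : ‖gradient u x‖ ^ 4 = (pd 0 u x ^ 2 + pd 1 u x ^ 2) ^ 2 := by
        rw [← norm_gradient_sq]
        ring
      rw [norm_gradient_norm_gradient_sq hux, lap_eq hux, h4, norm_gradient_sq, norm_gradient_sq,
        hV₀, hV₁,
        pd_flux (hd (hux.pd 0)) (hd (hux.pd 1)) (hd hξx) (hd (hξx.pd 0)) (hd (hξx.pd 1))
          (hd ((hux.pd 0).pd 1)) (hd ((hux.pd 1).pd 1)),
        pd_flux (hd (hux.pd 1)) (hd (hux.pd 0)) (hd hξx) (hd (hξx.pd 1)) (hd (hξx.pd 0))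
          (hd ((hux.pd 1).pd 0)) (hd ((hux.pd 0).pd 0)),
        pd_comm (hux.pd 0) 1 0, pd_comm (hux.pd 1) 1 0, pd_comm hux 1 0, pd_comm hξx 1 0]
      refine hpt.trans (le_of_eq ?_)
      ring
    _ = _ := by
      rw [integral_add (hdivi.const_mul 2).integrableOn (h3.const_mul 20).integrableOn,
        integral_const_mul, integral_const_mul, hdiv]
      ring
end
end

section
/- Let p > 2, let U ⊆ ℝ² be open, and let u ∈ C^∞(U) satisfy ∇u ≠ 0 in U and (p−2)·Δ∞u + |∇u|²·Δu = 0 in U. Then for every φ ∈ C_c^∞(U): ∫∫_U (|D²u∇u|²/|∇u|²) φ dx + (1/(p−2)) ∫∫_U (Δu)² φ dx = (1/2) ∫∫_U ( Δu·⟨∇u, ∇φ⟩ − Σ_{i,j=1}^{2} (∂²u/∂xᵢ∂xⱼ)(∂u/∂xⱼ)(∂φ/∂xᵢ) ) dx. -/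
open Set Metric MeasureTheory
open scoped RealInnerProductSpace

noncomputable section

/-- The partial derivative of `f` in the `i`-th coordinate direction. -/
def partialDeriv (i : Fin 2) (f : E2 → ℝ) (x : E2) : ℝ :=
  fderiv ℝ f x (EuclideanSpace.single i (1 : ℝ))

lemma gradient_apply_eq_partialDeriv (f : E2 → ℝ) (x : E2) (i : Fin 2) :
    gradient f x i = partialDeriv i f x := by
  have h : ⟪gradient f x, EuclideanSpace.single i (1 : ℝ)⟫ = partialDeriv i f x := by
    rw [gradient, InnerProductSpace.toDual_symm_apply, partialDeriv]
  rw [← h, EuclideanSpace.inner_single_right]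
  simp

lemma contDiff_partialDeriv {f : E2 → ℝ} (hf : ContDiff ℝ (⊤ : ℕ∞) f) (i : Fin 2) :
    ContDiff ℝ (⊤ : ℕ∞) (partialDeriv i f) :=
  (hf.fderiv_right (m := (⊤ : ℕ∞)) (by norm_cast)).clm_apply contDiff_const

lemma contDiff_gradient {f : E2 → ℝ} (hf : ContDiff ℝ (⊤ : ℕ∞) f) :
    ContDiff ℝ (⊤ : ℕ∞) (gradient f) :=
  (InnerProductSpace.toDual ℝ E2).symm.contDiff.comp
    (hf.fderiv_right (m := (⊤ : ℕ∞)) (by norm_cast))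

lemma fderiv_gradient_single_apply {f : E2 → ℝ} (hf : ContDiff ℝ (⊤ : ℕ∞) f) (x : E2)
    (i j : Fin 2) :
    (fderiv ℝ (gradient f) x (EuclideanSpace.single i (1 : ℝ))) j
      = partialDeriv i (partialDeriv j f) x := by
  have hd : DifferentiableAt ℝ (gradient f) x :=
    (contDiff_gradient hf).differentiable (by simp) x
  have h := (EuclideanSpace.proj j : E2 →L[ℝ] ℝ).hasFDerivAt.comp x
    hd.hasFDerivAt
  have he : (EuclideanSpace.proj j : E2 →L[ℝ] ℝ) ∘ gradient f
      = partialDeriv j f := by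
    ext y
    exact gradient_apply_eq_partialDeriv f y j
  rw [he] at h
  rw [partialDeriv, h.fderiv]
  rfl

lemma partialDeriv_comm {f : E2 → ℝ} (hf : ContDiff ℝ (⊤ : ℕ∞) f) (i j : Fin 2) :
    partialDeriv i (partialDeriv j f) = partialDeriv j (partialDeriv i f) := by
  ext x
  have hs : IsSymmSndFDerivAt ℝ f x :=
    hf.contDiffAt.isSymmSndFDerivAt (by rw [minSmoothness_of_isRCLikeNormedField]; norm_cast)
  have hd : DifferentiableAt ℝ (fderiv ℝ f) x :=
    (hf.fderiv_right (m := (⊤ : ℕ∞)) (by norm_cast)).differentiable (by simp) x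
  have key : ∀ k l : Fin 2, partialDeriv k (partialDeriv l f) x
      = fderiv ℝ (fderiv ℝ f) x (EuclideanSpace.single k 1) (EuclideanSpace.single l 1) := by
    intro k l
    change fderiv ℝ (fun y => fderiv ℝ f y (EuclideanSpace.single l (1 : ℝ))) x _ = _
    rw [fderiv_clm_apply hd (differentiableAt_const _)]
    simp
  rw [key, key, hs.eq]

lemma partialDeriv_mul {f g : E2 → ℝ} (hf : ContDiff ℝ (⊤ : ℕ∞) f)
    (hg : ContDiff ℝ (⊤ : ℕ∞) g) (i : Fin 2) (x : E2) :
    partialDeriv i (fun y => f y * g y) x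
      = partialDeriv i f x * g x + f x * partialDeriv i g x := by
  rw [partialDeriv, fderiv_fun_mul (hf.differentiable (by simp) x) (hg.differentiable (by simp) x)]
  simp [partialDeriv]
  ring

lemma partialDeriv_sub {f g : E2 → ℝ} (hf : ContDiff ℝ (⊤ : ℕ∞) f)
    (hg : ContDiff ℝ (⊤ : ℕ∞) g) (i : Fin 2) (x : E2) :
    partialDeriv i (fun y => f y - g y) x = partialDeriv i f x - partialDeriv i g x := by
  rw [partialDeriv, fderiv_fun_sub (hf.differentiable (by simp) x) (hg.differentiable (by simp) x)]
  rfl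

lemma clm_apply_eq_sum (A : E2 →L[ℝ] E2) (g : E2) (j : Fin 2) :
    (A g) j = g 0 * (A (EuclideanSpace.single 0 (1 : ℝ))) j
      + g 1 * (A (EuclideanSpace.single 1 (1 : ℝ))) j := by
  have hg : g = g 0 • EuclideanSpace.single 0 (1 : ℝ) + g 1 • EuclideanSpace.single 1 (1 : ℝ) := by
    ext k
    fin_cases k <;> simp
  conv_lhs => rw [hg]
  simp

lemma lap_eq_partialDeriv {f : E2 → ℝ} (hf : ContDiff ℝ (⊤ : ℕ∞) f) (x : E2) :
    lap f x = partialDeriv 0 (partialDeriv 0 f) x + partialDeriv 1 (partialDeriv 1 f) x := by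
  rw [lap, LinearMap.trace_eq_sum_inner _ (EuclideanSpace.basisFun (Fin 2) ℝ), Fin.sum_univ_two]
  simp only [EuclideanSpace.basisFun_apply, EuclideanSpace.inner_single_left,
    ContinuousLinearMap.coe_coe, fderiv_gradient_single_apply hf]
  simp

/-- The determinant of the Hessian. -/
def hessDet (f : E2 → ℝ) (x : E2) : ℝ :=
  partialDeriv 0 (partialDeriv 0 f) x * partialDeriv 1 (partialDeriv 1 f) x
    - partialDeriv 0 (partialDeriv 1 f) x ^ 2

lemma continuous_hessDet {f : E2 → ℝ} (hf : ContDiff ℝ (⊤ : ℕ∞) f) :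
    Continuous (hessDet f) := by
  have h := fun i j => (contDiff_partialDeriv (contDiff_partialDeriv hf j) i).continuous
  exact ((h 0 0).mul (h 1 1)).sub ((h 0 1).pow 2)

lemma continuous_lap {f : E2 → ℝ} (hf : ContDiff ℝ (⊤ : ℕ∞) f) : Continuous (lap f) := by
  have h := fun i j => (contDiff_partialDeriv (contDiff_partialDeriv hf j) i).continuous
  rw [funext (lap_eq_partialDeriv hf)]
  exact (h 0 0).add (h 1 1)

/-- Cayley–Hamilton for the Hessian, combined with the `p`-Laplace equation. -/
lemma norm_hessian_gradient_sq_div {p : ℝ} (hp : 2 < p) {f : E2 → ℝ}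
    (hf : ContDiff ℝ (⊤ : ℕ∞) f) {x : E2} (hne : gradient f x ≠ 0)
    (heq : (p - 2) * lapInf f x + ‖gradient f x‖ ^ 2 * lap f x = 0) :
    ‖fderiv ℝ (gradient f) x (gradient f x)‖ ^ 2 / ‖gradient f x‖ ^ 2
      = -hessDet f x - 1 / (p - 2) * lap f x ^ 2 := by
  have hp' : p - 2 ≠ 0 := by linarith
  have hn : ‖gradient f x‖ ^ 2 ≠ 0 := by simpa using hne
  have hsym : partialDeriv 1 (partialDeriv 0 f) x = partialDeriv 0 (partialDeriv 1 f) x := by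
    rw [partialDeriv_comm hf]
  have hI : lapInf f x = -(‖gradient f x‖ ^ 2 * lap f x) / (p - 2) := by
    field_simp
    linarith
  have hCH : ‖fderiv ℝ (gradient f) x (gradient f x)‖ ^ 2
      = lap f x * lapInf f x - hessDet f x * ‖gradient f x‖ ^ 2 := by
    rw [lap_eq_partialDeriv hf, lapInf, hessDet]
    simp only [EuclideanSpace.real_norm_sq_eq, PiLp.inner_apply, Fin.sum_univ_two,
      clm_apply_eq_sum, fderiv_gradient_single_apply hf, hsym]
    simp
    ring
  rw [hCH, hI]
  field_simp
  ring

lemma integral_mul_partialDeriv {f φ : E2 → ℝ} (hf : ContDiff ℝ (⊤ : ℕ∞) f)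
    (hφ : ContDiff ℝ (⊤ : ℕ∞) φ) (hφc : HasCompactSupport φ) (i : Fin 2) :
    Integrable (fun x => f x * partialDeriv i φ x) ∧
      Integrable (fun x => partialDeriv i f x * φ x) ∧
      ∫ x, f x * partialDeriv i φ x = -∫ x, partialDeriv i f x * φ x := by
  have h1 : Integrable (fun x => f x * partialDeriv i φ x) :=
    (hf.continuous.mul (contDiff_partialDeriv hφ i).continuous).integrable_of_hasCompactSupport
      ((hφc.fderiv_apply ℝ _).mul_left)
  have h2 : Integrable (fun x => partialDeriv i f x * φ x) :=
    ((contDiff_partialDeriv hf i).continuous.mul hφ.continuous).integrable_of_hasCompactSupport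
      hφc.mul_left
  have h3 : Integrable (fun x => f x * φ x) :=
    (hf.continuous.mul hφ.continuous).integrable_of_hasCompactSupport hφc.mul_left
  exact ⟨h1, h2, integral_mul_fderiv_eq_neg_fderiv_mul_of_integrable h2 h1 h3
    (fun x _ => hf.differentiable (by simp) x) (fun x _ => hφ.differentiable (by simp) x)⟩

/-- The distributional form of the Hessian determinant. -/
lemma integral_hessDet_mul {f φ : E2 → ℝ} (hf : ContDiff ℝ (⊤ : ℕ∞) f)
    (hφ : ContDiff ℝ (⊤ : ℕ∞) φ) (hφc : HasCompactSupport φ) :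
    ∫ x, (lap f x * ⟪gradient f x, gradient φ x⟫
          - ∑ i : Fin 2, ∑ j : Fin 2,
              (fderiv ℝ (gradient f) x (EuclideanSpace.single i (1 : ℝ))) j
                * gradient f x j * gradient φ x i)
      = -(2 * ∫ x, hessDet f x * φ x) := by
  have h1 := fun i => contDiff_partialDeriv hf i
  have h2 := fun i j => contDiff_partialDeriv (h1 j) i
  have hX0 : ContDiff ℝ (⊤ : ℕ∞) (fun x => partialDeriv 1 (partialDeriv 1 f) x * partialDeriv 0 f x
      - partialDeriv 0 (partialDeriv 1 f) x * partialDeriv 1 f x) :=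
    ((h2 1 1).mul (h1 0)).sub ((h2 0 1).mul (h1 1))
  have hX1 : ContDiff ℝ (⊤ : ℕ∞) (fun x => partialDeriv 0 (partialDeriv 0 f) x * partialDeriv 1 f x
      - partialDeriv 0 (partialDeriv 1 f) x * partialDeriv 0 f x) :=
    ((h2 0 0).mul (h1 1)).sub ((h2 0 1).mul (h1 0))
  obtain ⟨i0, j0, e0⟩ := integral_mul_partialDeriv hX0 hφ hφc 0
  obtain ⟨i1, j1, e1⟩ := integral_mul_partialDeriv hX1 hφ hφc 1
  have hsym : partialDeriv 1 (partialDeriv 0 f) = partialDeriv 0 (partialDeriv 1 f) :=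
    partialDeriv_comm hf 1 0
  have hL : ∀ x, (lap f x * ⟪gradient f x, gradient φ x⟫
          - ∑ i : Fin 2, ∑ j : Fin 2,
              (fderiv ℝ (gradient f) x (EuclideanSpace.single i (1 : ℝ))) j
                * gradient f x j * gradient φ x i)
      = (partialDeriv 1 (partialDeriv 1 f) x * partialDeriv 0 f x
          - partialDeriv 0 (partialDeriv 1 f) x * partialDeriv 1 f x) * partialDeriv 0 φ x
        + (partialDeriv 0 (partialDeriv 0 f) x * partialDeriv 1 f x
          - partialDeriv 0 (partialDeriv 1 f) x * partialDeriv 0 f x) * partialDeriv 1 φ x := by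
    intro x
    rw [lap_eq_partialDeriv hf]
    simp only [PiLp.inner_apply, Fin.sum_univ_two, fderiv_gradient_single_apply hf,
      gradient_apply_eq_partialDeriv, hsym]
    simp
    ring
  have hdiv : ∀ x,
      partialDeriv 0 (fun x => partialDeriv 1 (partialDeriv 1 f) x * partialDeriv 0 f x
          - partialDeriv 0 (partialDeriv 1 f) x * partialDeriv 1 f x) x * φ x
        + partialDeriv 1 (fun x => partialDeriv 0 (partialDeriv 0 f) x * partialDeriv 1 f x
          - partialDeriv 0 (partialDeriv 1 f) x * partialDeriv 0 f x) x * φ x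
      = 2 * (hessDet f x * φ x) := by
    intro x
    have c1 : partialDeriv 1 (partialDeriv 0 (partialDeriv 1 f)) x
        = partialDeriv 0 (partialDeriv 1 (partialDeriv 1 f)) x := by
      rw [partialDeriv_comm (h1 1)]
    have c0 : partialDeriv 1 (partialDeriv 0 (partialDeriv 0 f)) x
        = partialDeriv 0 (partialDeriv 0 (partialDeriv 1 f)) x := by
      rw [partialDeriv_comm (h1 0), hsym]
    rw [partialDeriv_sub ((h2 1 1).mul (h1 0)) ((h2 0 1).mul (h1 1)),
      partialDeriv_sub ((h2 0 0).mul (h1 1)) ((h2 0 1).mul (h1 0)),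
      partialDeriv_mul (h2 1 1) (h1 0), partialDeriv_mul (h2 0 1) (h1 1),
      partialDeriv_mul (h2 0 0) (h1 1), partialDeriv_mul (h2 0 1) (h1 0), c0, c1, hsym, hessDet]
    ring
  rw [integral_congr_ae (.of_forall hL), integral_add i0 i1, e0, e1, ← neg_add,
    ← integral_add j0 j1, integral_congr_ae (.of_forall hdiv), integral_const_mul]

/-- A function smooth on an open set agrees, near a closed subset of it, with a smooth function
on the whole plane. -/
lemma exists_contDiff_eventuallyEq {U K : Set E2} (hU : IsOpen U) (hK : IsClosed K) (hKU : K ⊆ U)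
    {u : E2 → ℝ} (hu : ContDiffOn ℝ (⊤ : ℕ∞) u U) :
    ∃ v : E2 → ℝ, ContDiff ℝ (⊤ : ℕ∞) v ∧ ∀ x ∈ K, u =ᶠ[nhds x] v := by
  obtain ⟨χ, h0, h1, -⟩ := exists_contMDiffMap_zero_one_nhds_of_isClosed
    (n := ⊤) (modelWithCornersSelf ℝ E2) hU.isClosed_compl hK
    (disjoint_compl_left_iff_subset.mpr hKU)
  rw [Filter.eventually_iff, mem_nhdsSet_iff_forall] at h0 h1
  refine ⟨fun x => χ x * u x, contDiff_iff_contDiffAt.mpr fun x => ?_, fun x hx => ?_⟩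
  · by_cases hx : x ∈ U
    · exact χ.contMDiff.contDiff.contDiffAt.mul (hu.contDiffAt (hU.mem_nhds hx))
    · refine (contDiffAt_const (c := (0 : ℝ))).congr_of_eventuallyEq ?_
      filter_upwards [h0 x hx] with y hy
      simp_all
  · filter_upwards [h1 x hx] with y hy
    simp_all

lemma integral_identity_of_contDiff {p : ℝ} (hp : 2 < p) {v φ : E2 → ℝ}
    (hv : ContDiff ℝ (⊤ : ℕ∞) v) (hφ : ContDiff ℝ (⊤ : ℕ∞) φ) (hφc : HasCompactSupport φ)
    (hne : ∀ x ∈ tsupport φ, gradient v x ≠ 0)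
    (hharm : ∀ x ∈ tsupport φ, (p - 2) * lapInf v x + ‖gradient v x‖ ^ 2 * lap v x = 0) :
    (∫ x, ‖fderiv ℝ (gradient v) x (gradient v x)‖ ^ 2 / ‖gradient v x‖ ^ 2 * φ x)
      + (1 / (p - 2)) * ∫ x, (lap v x) ^ 2 * φ x
    = (1 / 2) * ∫ x,
        (lap v x * ⟪gradient v x, gradient φ x⟫
          - ∑ i : Fin 2, ∑ j : Fin 2,
              (fderiv ℝ (gradient v) x (EuclideanSpace.single i (1 : ℝ))) j
                * gradient v x j * gradient φ x i) := by
  have hdet : Integrable (fun x => hessDet v x * φ x) :=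
    ((continuous_hessDet hv).mul hφ.continuous).integrable_of_hasCompactSupport hφc.mul_left
  have hlap : Integrable (fun x => lap v x ^ 2 * φ x) :=
    (((continuous_lap hv).pow 2).mul hφ.continuous).integrable_of_hasCompactSupport hφc.mul_left
  have hpt : ∀ x, ‖fderiv ℝ (gradient v) x (gradient v x)‖ ^ 2 / ‖gradient v x‖ ^ 2 * φ x
      = -(hessDet v x * φ x) - 1 / (p - 2) * (lap v x ^ 2 * φ x) := by
    intro x
    by_cases hx : x ∈ tsupport φ
    · rw [norm_hessian_gradient_sq_div hp hv (hne x hx) (hharm x hx)]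
      ring
    · simp [image_eq_zero_of_notMem_tsupport hx]
  rw [integral_hessDet_mul hv hφ hφc, integral_congr_ae (.of_forall hpt),
    integral_sub (f := fun x => -(hessDet v x * φ x)) hdet.neg (hlap.const_mul _), integral_neg,
    integral_const_mul]
  ring

/-- **Integral identity (formulas (2.7)–(2.8) of Koch–Zhang–Zhou, `p`-version).**
For a solution `u` of the `p`-Laplace equation with non-vanishing gradient and every
`φ ∈ C_c^∞(U)`:
`∫∫ (|D²u∇u|²/|∇u|²)φ + (1/(p−2)) ∫∫ (Δu)²φ
  = ½ ∫∫ (Δu⟨∇u,∇φ⟩ − Σᵢⱼ uₓᵢₓⱼ uₓⱼ φₓᵢ)`. -/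
theorem integral_identity_pLaplace
    (p : ℝ) (hp : 2 < p) (U : Set E2) (hU : IsOpen U)
    (u : E2 → ℝ) (hu : ContDiffOn ℝ (⊤ : ℕ∞) u U)
    (hne : ∀ x ∈ U, gradient u x ≠ 0)
    (hharm : ∀ x ∈ U, (p - 2) * lapInf u x + ‖gradient u x‖ ^ 2 * lap u x = 0)
    (φ : E2 → ℝ) (hφ : ContDiff ℝ (⊤ : ℕ∞) φ) (hφc : HasCompactSupport φ)
    (hφU : tsupport φ ⊆ U) :
    (∫ x in U, ‖fderiv ℝ (gradient u) x (gradient u x)‖ ^ 2 / ‖gradient u x‖ ^ 2 * φ x)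
      + (1 / (p - 2)) * ∫ x in U, (lap u x) ^ 2 * φ x
    = (1 / 2) * ∫ x in U,
        (lap u x * ⟪gradient u x, gradient φ x⟫
          - ∑ i : Fin 2, ∑ j : Fin 2,
              (fderiv ℝ (gradient u) x (EuclideanSpace.single i (1 : ℝ))) j
                * gradient u x j * gradient φ x i) := by
  obtain ⟨v, hv, huv⟩ := exists_contDiff_eventuallyEq hU (isClosed_tsupport φ) hφU hu
  have hg : ∀ x ∈ tsupport φ, gradient u x = gradient v x :=
    fun x hx => (huv x hx).gradient.eq_of_nhds
  have hH : ∀ x ∈ tsupport φ, fderiv ℝ (gradient u) x = fderiv ℝ (gradient v) x :=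
    fun x hx => (huv x hx).gradient.fderiv_eq
  have hlap : ∀ x ∈ tsupport φ, lap u x = lap v x := fun x hx => by rw [lap, lap, hH x hx]
  have hφ0 : ∀ x ∉ tsupport φ, φ x = 0 := fun x => image_eq_zero_of_notMem_tsupport
  have hdφ0 : ∀ x ∉ tsupport φ, gradient φ x = 0 := fun x hx => by
    rw [gradient, fderiv_of_notMem_tsupport ℝ hx, map_zero]
  have hout : ∀ x ∉ U, x ∉ tsupport φ := fun x hx h => hx (hφU h)
  rw [setIntegral_eq_integral_of_forall_compl_eq_zero fun x hx => by simp [hφ0 x (hout x hx)],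
    setIntegral_eq_integral_of_forall_compl_eq_zero fun x hx => by simp [hφ0 x (hout x hx)],
    setIntegral_eq_integral_of_forall_compl_eq_zero fun x hx => by simp [hdφ0 x (hout x hx)]]
  convert integral_identity_of_contDiff hp hv hφ hφc
    (fun x hx => hg x hx ▸ hne x (hφU hx)) (fun x hx => ?_) using 3
  · funext x
    by_cases hx : x ∈ tsupport φ
    · rw [hg x hx, hH x hx]
    · simp [hφ0 x hx]
  · refine integral_congr_ae (.of_forall fun x => ?_)
    by_cases hx : x ∈ tsupport φ
    · simp only [hlap x hx]
    · simp [hφ0 x hx]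
  · funext x
    by_cases hx : x ∈ tsupport φ
    · rw [hg x hx, hH x hx, hlap x hx]
    · simp [hdφ0 x hx]
  · have h := hharm x (hφU hx)
    rwa [lapInf, hg x hx, hH x hx, hlap x hx] at h
end
end

section
/- Let D ⊆ ℝ² be open, C > 0 a constant, and v ∈ C¹(D) a solution of the Eikonal Equation |∇v(x)| = C for all x ∈ D. If γ : I → D is differentiable on an interval I and γ'(t) = ∇v(γ(t)) for all t ∈ I, then ∇v(γ(t)) is constant on I and γ(t) = γ(t₀) + (t − t₀)·∇v(γ(t₀)) for all t, t₀ ∈ I; that is, every streamline of v is a segment of a straight line. Consequently, if two such streamlines have intersecting images, their images lie on one and the same straight line. -/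
open Set Metric
open scoped RealInnerProductSpace

noncomputable section

section Streamlines

variable {F : Type*} [NormedAddCommGroup F] [InnerProductSpace ℝ F]

/-- A function with zero derivative within a convex set of reals is constant on it. -/
theorem Convex.eq_of_hasDerivWithinAt_zero {s : Set ℝ} (hs : Convex ℝ s) {f : ℝ → F}
    (hf : ∀ t ∈ s, HasDerivWithinAt f 0 s t) {x y : ℝ} (hx : x ∈ s) (hy : y ∈ s) :
    f x = f y := by
  have h := hs.norm_image_sub_le_of_norm_hasDerivWithin_le (C := 0) hf (by simp) hy hx
  rw [zero_mul, norm_le_zero_iff] at h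
  exact sub_eq_zero.mp h

/-- A curve whose chords all have length `C * |t - s|` is parametrized affinely. -/
theorem sub_eq_smul_of_norm_sub_eq {J : Set ℝ} {γ : ℝ → F} {C : ℝ}
    (h : ∀ s ∈ J, ∀ t ∈ J, ‖γ t - γ s‖ = C * |t - s|) {s t u : ℝ}
    (hs : s ∈ J) (ht : t ∈ J) (hu : u ∈ J) :
    (t - s) • (γ u - γ s) = (u - s) • (γ t - γ s) := by
  have hsq : ∀ a ∈ J, ∀ b ∈ J, ‖γ b - γ a‖ ^ 2 = C ^ 2 * (b - a) ^ 2 := by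
    intro a ha b hb
    rw [h a ha b hb, mul_pow, sq_abs]
  have hinner := norm_sub_sq_real (γ u - γ s) (γ t - γ s)
  rw [sub_sub_sub_cancel_right, hsq t ht u hu, hsq s hs u hu, hsq s hs t ht] at hinner
  have hzero := norm_sub_sq_real ((t - s) • (γ u - γ s)) ((u - s) • (γ t - γ s))
  rw [norm_smul, norm_smul, mul_pow, mul_pow, hsq s hs u hu, hsq s hs t ht,
    real_inner_smul_left, real_inner_smul_right, Real.norm_eq_abs, Real.norm_eq_abs,
    sq_abs, sq_abs] at hzero
  have : ‖(t - s) • (γ u - γ s) - (u - s) • (γ t - γ s)‖ ^ 2 = 0 := by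
    rw [hzero]
    linear_combination -(t - s) * (u - s) * hinner
  exact sub_eq_zero.mp (norm_eq_zero.mp (pow_eq_zero_iff two_ne_zero |>.mp this))

variable [CompleteSpace F]

/-- A streamline of a solution of the Eikonal Equation on a convex set is parametrized
proportionally to the chord length. -/
theorem norm_sub_eq_of_eikonal {B : Set F} (hB : Convex ℝ B) {C : ℝ} (hC : 0 < C)
    {v : F → ℝ} {Dv : F → F} (hDv : ∀ x ∈ B, HasGradientAt v (Dv x) x)
    (heik : ∀ x ∈ B, ‖Dv x‖ = C) {J : Set ℝ} (hJ : Convex ℝ J) {γ : ℝ → F}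
    (hmem : ∀ t ∈ J, γ t ∈ B) (hode : ∀ t ∈ J, HasDerivWithinAt γ (Dv (γ t)) J t)
    {s t : ℝ} (hs : s ∈ J) (ht : t ∈ J) : ‖γ t - γ s‖ = C * |t - s| := by
  have hupper : ‖γ t - γ s‖ ≤ C * |t - s| :=
    hJ.norm_image_sub_le_of_norm_hasDerivWithin_le hode
      (fun u hu => (heik _ (hmem u hu)).le) hs ht
  have hlip : ‖v (γ t) - v (γ s)‖ ≤ C * ‖γ t - γ s‖ :=
    hB.norm_image_sub_le_of_norm_hasFDerivWithin_le
      (fun x hx => (hDv x hx).hasFDerivAt.hasFDerivWithinAt)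
      (fun x hx => by simp [heik x hx]) (hmem s hs) (hmem t ht)
  have hcomp : v (γ t) - C ^ 2 * t = v (γ s) - C ^ 2 * s := by
    refine hJ.eq_of_hasDerivWithinAt_zero (f := fun u => v (γ u) - C ^ 2 * u) ?_ ht hs
    intro u hu
    have h1 := (hDv _ (hmem u hu)).hasFDerivAt.comp_hasDerivWithinAt u (hode u hu)
    rw [InnerProductSpace.toDual_apply_apply, real_inner_self_eq_norm_sq,
      heik _ (hmem u hu)] at h1
    have h2 := h1.sub ((hasDerivWithinAt_id u J).const_mul (C ^ 2))
    rw [mul_one, sub_self] at h2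
    exact h2
  have hval : v (γ t) - v (γ s) = C ^ 2 * (t - s) := by linear_combination hcomp
  rw [hval, Real.norm_eq_abs, abs_mul, abs_of_pos (pow_pos hC 2), pow_two, mul_assoc] at hlip
  exact hupper.antisymm (le_of_mul_le_mul_left hlip hC)

/-- The gradient of a solution of the Eikonal Equation on a convex set is constant along
streamlines. -/
theorem gradient_eq_of_eikonal_of_convex {B : Set F} (hB : Convex ℝ B) {C : ℝ} (hC : 0 < C)
    {v : F → ℝ} {Dv : F → F} (hDv : ∀ x ∈ B, HasGradientAt v (Dv x) x)
    (heik : ∀ x ∈ B, ‖Dv x‖ = C) {J : Set ℝ} (hJ : Convex ℝ J) {γ : ℝ → F}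
    (hmem : ∀ t ∈ J, γ t ∈ B) (hode : ∀ t ∈ J, HasDerivWithinAt γ (Dv (γ t)) J t)
    {s t : ℝ} (hs : s ∈ J) (ht : t ∈ J) : Dv (γ t) = Dv (γ s) := by
  rcases eq_or_ne t s with rfl | hne
  · rfl
  have huniq : UniqueDiffOn ℝ J :=
    uniqueDiffOn_convex hJ (hJ.nontrivial_iff_nonempty_interior.mp ⟨t, ht, s, hs, hne⟩)
  have hgrad : ∀ u ∈ J, Dv (γ u) = (t - s)⁻¹ • (γ t - γ s) := by
    intro u hu
    have haffine : ∀ r ∈ J, γ r = (r - s) • ((t - s)⁻¹ • (γ t - γ s)) + γ s := by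
      intro r hr
      have h := sub_eq_smul_of_norm_sub_eq
        (fun a ha b hb => norm_sub_eq_of_eikonal hB hC hDv heik hJ hmem hode ha hb) hs ht hr
      rw [smul_comm, ← h, inv_smul_smul₀ (sub_ne_zero.mpr hne), sub_add_cancel]
    have hderiv := ((((hasDerivWithinAt_id u J).sub_const s).smul_const
      ((t - s)⁻¹ • (γ t - γ s))).add_const (γ s)).congr haffine (haffine u hu)
    rw [one_smul] at hderiv
    exact (huniq u hu).eq_deriv _ (hode u hu) hderiv
  rw [hgrad t ht, hgrad s hs]

/-- The gradient of a solution of the Eikonal Equation is constant along streamlines. -/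
theorem gradient_eq_of_eikonal {D : Set F} (hD : IsOpen D) {C : ℝ} (hC : 0 < C)
    {v : F → ℝ} {Dv : F → F} (hDv : ∀ x ∈ D, HasGradientAt v (Dv x) x)
    (heik : ∀ x ∈ D, ‖Dv x‖ = C) {I : Set ℝ} (hI : I.OrdConnected) {γ : ℝ → F}
    (hmem : ∀ t ∈ I, γ t ∈ D) (hode : ∀ t ∈ I, HasDerivWithinAt γ (Dv (γ t)) I t)
    {s t : ℝ} (hs : s ∈ I) (ht : t ∈ I) : Dv (γ t) = Dv (γ s) := by
  refine hI.convex.eq_of_hasDerivWithinAt_zero (f := fun u => Dv (γ u)) ?_ ht hs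
  intro u hu
  obtain ⟨r, hr, hball⟩ := Metric.isOpen_iff.mp hD _ (hmem u hu)
  obtain ⟨δ, hδ, hsub⟩ := Metric.mem_nhdsWithin_iff.mp
    ((hode u hu).continuousWithinAt (Metric.ball_mem_nhds (γ u) hr))
  have hmemJ : u ∈ ball u δ ∩ I := ⟨mem_ball_self hδ, hu⟩
  refine (hasDerivWithinAt_const u I (Dv (γ u))).congr_of_eventuallyEq ?_ rfl
  filter_upwards [inter_mem_nhdsWithin I (ball_mem_nhds u hδ)] with w hw
  exact gradient_eq_of_eikonal_of_convex (convex_ball (γ u) r) hC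
    (fun x hx => hDv x (hball hx)) (fun x hx => heik x (hball hx))
    ((convex_ball u δ).inter hI.convex) (fun a ha => hsub ha)
    (fun a ha => (hode a ha.2).mono inter_subset_right) hmemJ hw.symm

/-- Streamlines of a solution of the Eikonal Equation are straight lines. -/
theorem streamline_eq_of_eikonal {D : Set F} (hD : IsOpen D) {C : ℝ} (hC : 0 < C)
    {v : F → ℝ} {Dv : F → F} (hDv : ∀ x ∈ D, HasGradientAt v (Dv x) x)
    (heik : ∀ x ∈ D, ‖Dv x‖ = C) {I : Set ℝ} (hI : I.OrdConnected) {γ : ℝ → F}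
    (hmem : ∀ t ∈ I, γ t ∈ D) (hode : ∀ t ∈ I, HasDerivWithinAt γ (Dv (γ t)) I t)
    {s t : ℝ} (hs : s ∈ I) (ht : t ∈ I) : γ t = γ s + (t - s) • Dv (γ s) := by
  have h : γ t - (t - s) • Dv (γ s) = γ s - (s - s) • Dv (γ s) := by
    refine hI.convex.eq_of_hasDerivWithinAt_zero
      (f := fun u => γ u - (u - s) • Dv (γ s)) ?_ ht hs
    intro u hu
    have h1 := (hode u hu).sub
      (((hasDerivWithinAt_id u I).sub_const s).smul_const (Dv (γ s)))
    rwa [one_smul, gradient_eq_of_eikonal hD hC hDv heik hI hmem hode hs hu, sub_self] at h1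
  rw [sub_self, zero_smul, sub_zero] at h
  exact sub_eq_iff_eq_add.mp h

end Streamlines

/-- **Streamlines of the Eikonal Equation are straight lines.** If `v ∈ C¹(D)` solves
`|∇v| = C` in `D`, then along any streamline `γ` of `v` the gradient is constant and
`γ(t) = γ(t₀) + (t − t₀)∇v(γ(t₀))`; consequently two streamlines with intersecting
images lie on one and the same straight line. -/
theorem eikonal_streamlines_are_lines
    (D : Set E2) (hD : IsOpen D) (C : ℝ) (hC : 0 < C)
    (v : E2 → ℝ) (Dv : E2 → E2)
    (hv : ContDiffOn ℝ 1 v D)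
    (hDv : ∀ x ∈ D, HasGradientAt v (Dv x) x)
    (heik : ∀ x ∈ D, ‖Dv x‖ = C)
    (I : Set ℝ) (hI : I.OrdConnected) (γ : ℝ → E2)
    (hmem : ∀ t ∈ I, γ t ∈ D)
    (hode : ∀ t ∈ I, HasDerivWithinAt γ (Dv (γ t)) I t) :
    (∀ t ∈ I, ∀ t₀ ∈ I, Dv (γ t) = Dv (γ t₀)) ∧
    (∀ t ∈ I, ∀ t₀ ∈ I, γ t = γ t₀ + (t - t₀) • Dv (γ t₀)) ∧
    (∀ (I₂ : Set ℝ), I₂.OrdConnected → ∀ γ₂ : ℝ → E2,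
      (∀ t ∈ I₂, γ₂ t ∈ D) → (∀ t ∈ I₂, HasDerivWithinAt γ₂ (Dv (γ₂ t)) I₂ t) →
      (∃ x, x ∈ γ '' I ∧ x ∈ γ₂ '' I₂) →
      ∃ p w : E2, (∀ t ∈ I, ∃ c : ℝ, γ t = p + c • w) ∧
        (∀ t ∈ I₂, ∃ c : ℝ, γ₂ t = p + c • w)) := by
  refine ⟨fun t ht t₀ ht₀ => gradient_eq_of_eikonal hD hC hDv heik hI hmem hode ht₀ ht,
    fun t ht t₀ ht₀ => streamline_eq_of_eikonal hD hC hDv heik hI hmem hode ht₀ ht, ?_⟩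
  rintro I₂ hI₂ γ₂ hmem₂ hode₂ ⟨x, ⟨t₁, ht₁, rfl⟩, ⟨t₂, ht₂, h⟩⟩
  refine ⟨γ t₁, Dv (γ t₁), fun t ht => ⟨t - t₁, ?_⟩, fun t ht => ⟨t - t₂, ?_⟩⟩
  · exact streamline_eq_of_eikonal hD hC hDv heik hI hmem hode ht₁ ht
  · rw [← h]
    exact streamline_eq_of_eikonal hD hC hDv heik hI₂ hmem₂ hode₂ ht₂ ht
end
end
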